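/- arXiv:2004.07354 — 7 statements merged into one kernel-verified Lean document; each statement's English description precedes it below -/
import Mathlib

section
/- Let S be an HV-convex polyomino (a finite, 4-connected, horizontally and vertically convex subset of ℤ²). If (x,y) and (x',y') are two distinct points of S with x ≤ x' and y ≤ y', then (x+1,y) ∈ S or (x,y+1) ∈ S. -/
/-- Two lattice points are 4-adjacent if their Euclidean distance is 1. -/
def Adj (p q : ℤ × ℤ) : Prop := (p.1 - q.1) ^ 2 + (p.2 - q.2) ^ 2 = 1

/-- A polyomino is a finite nonempty subset of ℤ² any two of whose points are
joined by a 4-connected path (a sequence of distinct points, consecutive ones at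
distance 1) lying entirely in the set. -/
def IsPolyomino (S : Set (ℤ × ℤ)) : Prop :=
  S.Finite ∧ S.Nonempty ∧
    ∀ p ∈ S, ∀ q ∈ S, ∃ l : List (ℤ × ℤ),
      l.Nodup ∧ l.Chain' Adj ∧ l.head? = some p ∧ l.getLast? = some q ∧
      ∀ z ∈ l, z ∈ S

/-- A set S ⊆ ℤ² is HV-convex if its intersection with every horizontal and
every vertical line is a set of consecutive lattice points. -/
def HVConvex (S : Set (ℤ × ℤ)) : Prop :=
  (∀ x x'' x' y : ℤ, (x, y) ∈ S → (x', y) ∈ S → x ≤ x'' → x'' ≤ x' → (x'', y) ∈ S) ∧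
  (∀ x y y'' y' : ℤ, (x, y) ∈ S → (x, y') ∈ S → y ≤ y'' → y'' ≤ y' → (x, y'') ∈ S)

/-- Adjacent lattice points agree in one coordinate and differ by one in the other. -/
theorem Adj.cases {a b c d : ℤ} (h : Adj (a, b) (c, d)) :
    (a = c ∧ (d = b + 1 ∨ d = b - 1)) ∨ (b = d ∧ (c = a + 1 ∨ c = a - 1)) := by
  have h' : (a - c) ^ 2 + (b - d) ^ 2 = 1 := h
  have h₁ : -1 ≤ a - c ∧ a - c ≤ 1 := by constructor <;> nlinarith [sq_nonneg (b - d)]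
  have h₂ : -1 ≤ b - d ∧ b - d ≤ 1 := by constructor <;> nlinarith [sq_nonneg (a - c)]
  generalize hu : a - c = u at *
  generalize hv : b - d = v at *
  obtain ⟨_, _⟩ := h₁
  obtain ⟨_, _⟩ := h₂
  interval_cases u <;> interval_cases v <;> omega

/-- A property that passes from a point of `S` to its neighbours in `S` passes from the first
point of a path in `S` to the last one. -/
theorem path_invariant {S : Set (ℤ × ℤ)} {P : ℤ × ℤ → Prop}
    (hP : ∀ p ∈ S, ∀ q ∈ S, Adj p q → P p → P q) (l : List (ℤ × ℤ)) (p q : ℤ × ℤ)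
    (hl : l.IsChain Adj) (hS : ∀ z ∈ l, z ∈ S) (hp : l.head? = some p)
    (hq : l.getLast? = some q) (h : P p) : P q := by
  induction l generalizing p with
  | nil => simp at hp
  | cons a l ih =>
    obtain rfl : a = p := by simpa using hp
    cases l with
    | nil =>
      obtain rfl : a = q := by simpa using hq
      exact h
    | cons b l =>
      rw [List.isChain_cons_cons] at hl
      exact ih b hl.2 (fun z hz => hS z (List.mem_cons_of_mem _ hz)) rfl
        (by simpa using hq) (hP a (hS a (by simp)) b (hS b (by simp)) hl.1 h)

theorem hv_convex_polyomino_staircase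
    (S : Set (ℤ × ℤ)) (hpoly : IsPolyomino S) (hhv : HVConvex S)
    (x y x' y' : ℤ) (h1 : (x, y) ∈ S) (h2 : (x', y') ∈ S)
    (hne : (x, y) ≠ (x', y')) (hx : x ≤ x') (hy : y ≤ y') :
    (x + 1, y) ∈ S ∨ (x, y + 1) ∈ S := by
  by_contra! hcon
  obtain ⟨hright, hup⟩ := hcon
  have hrow : ∀ t, x < t → (t, y) ∉ S := fun t ht hS =>
    hright (hhv.1 x (x + 1) t y h1 hS (by omega) ht)
  have hcol : ∀ s, y < s → (x, s) ∉ S := fun s hs hS =>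
    hup (hhv.2 x y (y + 1) s h1 hS (by omega) hs)
  have hquad : x < x' ∧ y < y' := by
    rcases hx.eq_or_lt with rfl | hx
    · rcases hy.eq_or_lt with rfl | hy
      · exact absurd rfl hne
      · exact absurd h2 (hcol y' hy)
    · rcases hy.eq_or_lt with rfl | hy
      · exact absurd h2 (hrow x' hx)
      · exact ⟨hx, hy⟩
  obtain ⟨l, -, hchain, hhead, hlast, hlS⟩ := hpoly.2.2 _ h2 _ h1
  refine lt_irrefl x (path_invariant (S := S) (P := fun p => x < p.1 ∧ y < p.2) ?_ l _ _
    hchain hlS hhead hlast hquad).1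
  rintro ⟨a, b⟩ - ⟨c, d⟩ hq hadj ⟨ha, hb⟩
  dsimp only at ha hb ⊢
  have hc : y < d → c ≠ x := by
    rintro hyd rfl
    exact hcol d hyd hq
  have hd : x < c → d ≠ y := by
    rintro hxc rfl
    exact hrow c hxc hq
  have := hadj.cases
  omega
end

section
/- Let S be an HV-convex polyomino and let ℓ ≥ 1 be an integer. For y ∈ ℤ, call the set R_y = {x ∈ ℤ : (x,y) ∈ S} the row of S at height y, and let Y = {y ∈ ℤ : |R_y| = ℓ} be the set of heights of rows of length ℓ; for y ∈ Y let r(y) = max R_y be the x-coordinate of the right endpoint of that row. Then r is monotone on Y: either r(y) ≤ r(y') holds for all y, y' ∈ Y with y ≤ y', or r(y) ≥ r(y') holds for all y, y' ∈ Y with y ≤ y'. -/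
/-- A 4-connected path that starts inside `A` and ends outside `A` has a step leaving `A`. -/
theorem exists_adj_leaving_of_isChain (A : Set (ℤ × ℤ)) (q : ℤ × ℤ) (hq : q ∉ A)
    (l : List (ℤ × ℤ)) (p : ℤ × ℤ) (hp : p ∈ A) (hl : l.IsChain Adj)
    (hhead : l.head? = some p) (hlast : l.getLast? = some q) :
    ∃ z ∈ l, ∃ w ∈ l, z ∈ A ∧ w ∉ A ∧ Adj z w := by
  induction l generalizing p with
  | nil => simp at hhead
  | cons a t ih =>
    obtain rfl : a = p := by simpa using hhead
    cases t with
    | nil =>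
      obtain rfl : a = q := by simpa using hlast
      exact absurd hp hq
    | cons b t =>
      rw [List.isChain_cons_cons] at hl
      by_cases hb : b ∈ A
      · obtain ⟨z, hz, w, hw, h⟩ := ih b hb hl.2 rfl (by simpa using hlast)
        exact ⟨z, List.mem_cons_of_mem _ hz, w, List.mem_cons_of_mem _ hw, h⟩
      · exact ⟨a, by simp, b, by simp, hp, hb, hl.1⟩

theorem IsPolyomino.exists_adj_leaving {S : Set (ℤ × ℤ)} (hS : IsPolyomino S)
    (A : Set (ℤ × ℤ)) {p q : ℤ × ℤ} (hp : p ∈ S) (hq : q ∈ S) (hpA : p ∈ A) (hqA : q ∉ A) :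
    ∃ z ∈ S, ∃ w ∈ S, z ∈ A ∧ w ∉ A ∧ Adj z w := by
  obtain ⟨l, -, hl, hhead, hlast, hmem⟩ := hS.2.2 p hp q hq
  obtain ⟨z, hz, w, hw, h⟩ := exists_adj_leaving_of_isChain A q hqA l p hpA hl hhead hlast
  exact ⟨z, hmem z hz, w, hmem w hw, h⟩

theorem Adj.coordinates {p q : ℤ × ℤ} (h : Adj p q) :
    (p.1 = q.1 ∧ (p.2 = q.2 + 1 ∨ q.2 = p.2 + 1)) ∨
      (p.2 = q.2 ∧ (p.1 = q.1 + 1 ∨ q.1 = p.1 + 1)) := by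
  unfold Adj at h
  have h₁ : (p.1 - q.1) ≤ 1 := by nlinarith [sq_nonneg (p.2 - q.2)]
  have h₂ : -1 ≤ (p.1 - q.1) := by nlinarith [sq_nonneg (p.2 - q.2)]
  have h₃ : (p.2 - q.2) ≤ 1 := by nlinarith [sq_nonneg (p.1 - q.1)]
  have h₄ : -1 ≤ (p.2 - q.2) := by nlinarith [sq_nonneg (p.1 - q.1)]
  generalize hu : p.1 - q.1 = u at *
  generalize hv : p.2 - q.2 = v at *
  interval_cases u <;> interval_cases v <;> omega

/-- Let `S` have a point in the open quadrant with corner `(c, b)` and signs `-ε`, `δ`. If `S`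
meets column `c` on the other side of row `b`, and meets row `b`, then it does so on the near
side of column `c`. -/
theorem HVConvex.exists_mem_row_of_quadrant {S : Set (ℤ × ℤ)} (hS : IsPolyomino S)
    (hc : HVConvex S) {ε δ : ℤ} (hε : ε = 1 ∨ ε = -1) (hδ : δ = 1 ∨ δ = -1)
    {x y c a b s : ℤ} (hp : (x, y) ∈ S) (hxc : ε * x < ε * c) (hby : δ * b < δ * y)
    (hca : (c, a) ∈ S) (hab : δ * a ≤ δ * b) (hs : (s, b) ∈ S) :
    ∃ t, (t, b) ∈ S ∧ ε * t ≤ ε * c := by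
  obtain ⟨⟨z₁, z₂⟩, hz, ⟨w₁, w₂⟩, hw, ⟨hz₁, hz₂⟩, hwA, hadj⟩ :=
    hS.exists_adj_leaving {p | ε * p.1 < ε * c ∧ δ * b < δ * p.2} hp hs ⟨hxc, hby⟩
      (fun h => lt_irrefl _ h.2)
  have hzw := hadj.coordinates
  simp only [Set.mem_ofPred_eq, not_and_or, not_lt] at hz₁ hz₂ hwA hzw
  have hcases : (w₁ = c ∧ δ * b ≤ δ * w₂) ∨ (w₂ = b ∧ ε * w₁ ≤ ε * c) := by
    rcases hε with rfl | rfl <;> rcases hδ with rfl | rfl <;> omega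
  rcases hcases with ⟨rfl, h⟩ | ⟨rfl, h⟩
  · refine ⟨w₁, ?_, le_rfl⟩
    rcases hδ with rfl | rfl
    · exact hc.2 w₁ a b w₂ hca hw (by omega) (by omega)
    · exact hc.2 w₁ w₂ b a hw hca (by omega) (by omega)
  · exact ⟨w₁, hw, h⟩

/-- The `ε`-side boundary of an HV-convex polyomino is unimodal in the height. -/
theorem HVConvex.exists_mem_row_between {S : Set (ℤ × ℤ)} (hS : IsPolyomino S)
    (hc : HVConvex S) {ε : ℤ} (hε : ε = 1 ∨ ε = -1)
    {x₁ x₂ x₃ y₁ y₂ y₃ : ℤ} (h₁ : (x₁, y₁) ∈ S) (h₂ : (x₂, y₂) ∈ S) (h₃ : (x₃, y₃) ∈ S)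
    (h₁₂ : y₁ < y₂) (h₂₃ : y₂ < y₃) :
    ∃ t, (t, y₂) ∈ S ∧ (ε * t ≤ ε * x₁ ∨ ε * t ≤ ε * x₃) := by
  rcases lt_trichotomy (ε * x₁) (ε * x₃) with h | h | h
  · obtain ⟨t, ht, hle⟩ := hc.exists_mem_row_of_quadrant hS hε (Or.inr rfl) h₁ h
      (by omega) h₃ (by omega) h₂
    exact ⟨t, ht, Or.inr hle⟩
  · obtain rfl : x₁ = x₃ := by rcases hε with rfl | rfl <;> omega
    exact ⟨x₁, hc.2 x₁ y₁ y₂ y₃ h₁ h₃ h₁₂.le h₂₃.le, Or.inl le_rfl⟩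
  · obtain ⟨t, ht, hle⟩ := hc.exists_mem_row_of_quadrant hS hε (Or.inl rfl) h₃ h
      (by omega) h₁ (by omega) h₂
    exact ⟨t, ht, Or.inl hle⟩

theorem HVConvex.isLeast_row {S : Set (ℤ × ℤ)} (hfin : S.Finite) (hc : HVConvex S) {y r : ℤ}
    (hr : IsGreatest {x : ℤ | (x, y) ∈ S} r) :
    IsLeast {x : ℤ | (x, y) ∈ S} (r + 1 - Set.ncard {x : ℤ | (x, y) ∈ S}) := by
  have hrow : {x : ℤ | (x, y) ∈ S}.Finite :=
    hfin.preimage (fun a _ b _ h => congrArg Prod.fst h : Set.InjOn (fun x : ℤ => (x, y)) _)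
  obtain ⟨m, hm, hmin⟩ := Set.exists_min_image _ id hrow ⟨r, hr.1⟩
  have hIcc : {x : ℤ | (x, y) ∈ S} = Set.Icc m r := by
    ext x
    exact ⟨fun hx => ⟨hmin x hx, hr.2 hx⟩, fun hx => hc.1 m x r y hm hr.1 hx.1 hx.2⟩
  have hmr : m ≤ r := hr.2 hm
  have hcard : (Set.ncard {x : ℤ | (x, y) ∈ S} : ℤ) = r + 1 - m := by
    rw [hIcc, ← Finset.coe_Icc, Set.ncard_coe_finset, Int.card_Icc]
    omega
  rw [hcard, sub_sub_cancel]
  exact ⟨hm, fun x hx => hmin x hx⟩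

theorem hv_convex_row_right_endpoints_monotone
    (S : Set (ℤ × ℤ)) (hpoly : IsPolyomino S) (hhv : HVConvex S)
    (ℓ : ℕ) (hℓ : 1 ≤ ℓ)
    (Y : Set ℤ) (hY : Y = {y : ℤ | Set.ncard {x : ℤ | (x, y) ∈ S} = ℓ})
    (r : ℤ → ℤ) (hr : ∀ y ∈ Y, IsGreatest {x : ℤ | (x, y) ∈ S} (r y)) :
    (∀ y ∈ Y, ∀ y' ∈ Y, y ≤ y' → r y ≤ r y') ∨
    (∀ y ∈ Y, ∀ y' ∈ Y, y ≤ y' → r y' ≤ r y) := by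
  have hleft : ∀ y ∈ Y, IsLeast {x : ℤ | (x, y) ∈ S} (r y + 1 - ℓ) := by
    intro y hy
    have h := hhv.isLeast_row hpoly.1 (hr y hy)
    rw [hY] at hy
    rwa [hy] at h
  suffices h : MonotoneOn r Y ∨ AntitoneOn r Y from
    h.imp (fun h y hy y' hy' => h hy hy') (fun h y hy y' hy' => h hy hy')
  by_contra hcon
  rw [not_or, Set.not_monotoneOn_not_antitoneOn_iff_exists_lt_lt] at hcon
  obtain ⟨a, ha, b, hb, c, hc, hab, hbc, ⟨h₁, h₂⟩ | ⟨h₁, h₂⟩⟩ := hcon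
  · obtain ⟨t, ht, h⟩ := hhv.exists_mem_row_between hpoly (Or.inl rfl)
      (hleft a ha).1 (hleft b hb).1 (hleft c hc).1 hab hbc
    have := (hleft b hb).2 ht
    omega
  · obtain ⟨t, ht, h⟩ := hhv.exists_mem_row_between hpoly (Or.inr rfl)
      (hr a ha).1 (hr b hb).1 (hr c hc).1 hab hbc
    have := (hr b hb).2 ht
    omega
end

section
/- For any finite nonempty digital convex set S ⊆ ℤ², the lattice width of S satisfies w(S) ≤ ⌊(4/3)·d(S)⌋ + 1, where d(S) is the lattice diameter of S. -/
/-- The canonical embedding of ℤ² into ℝ². -/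
def toR2 (z : ℤ × ℤ) : ℝ × ℝ := ((z.1 : ℝ), (z.2 : ℝ))

/-- A set S ⊆ ℤ² is digital convex if conv(S) ∩ ℤ² = S. -/
def DigitalConvex (S : Set (ℤ × ℤ)) : Prop :=
  {z : ℤ × ℤ | toR2 z ∈ convexHull ℝ (toR2 '' S)} = S

/-- The lattice width of S: the minimum over nonzero u ∈ ℤ² of the maximum
over a, b ∈ S of u·(b − a). -/
noncomputable def latticeWidth (S : Set (ℤ × ℤ)) : ℤ :=
  sInf {w : ℤ | ∃ u : ℤ × ℤ, u ≠ 0 ∧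
    w = sSup {d : ℤ | ∃ a ∈ S, ∃ b ∈ S,
      d = u.1 * (b.1 - a.1) + u.2 * (b.2 - a.2)}}

/-- The lattice diameter of S: the maximum, over all lines in ℝ², of the number
of points of S lying on the line, minus 1. -/
noncomputable def latticeDiameter (S : Set (ℤ × ℤ)) : ℤ :=
  ((sSup {m : ℕ | ∃ a v : ℝ × ℝ, v ≠ 0 ∧
    m = Set.ncard {z ∈ S | ∃ t : ℝ, toR2 z = a + t • v}} : ℕ) : ℤ) - 1

/-- A symmetric convex planar set is closed under nonnegative combinations of total weight at
most one, here written with a common denominator `δ`. -/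
lemma mem_of_combination {C : Set (ℝ × ℝ)} (hconv : Convex ℝ C) (hsymm : ∀ c ∈ C, -c ∈ C)
    {p q z : ℝ × ℝ} (hp : p ∈ C) (hq : q ∈ C) {α β δ : ℝ} (hα : 0 ≤ α) (hβ : 0 ≤ β)
    (hδ : 0 < δ) (hsum : α + β ≤ δ) (h1 : δ * z.1 = α * p.1 + β * q.1)
    (h2 : δ * z.2 = α * p.2 + β * q.2) : z ∈ C := by
  have h0 : (0 : ℝ × ℝ) ∈ C := by
    have := hconv hp (hsymm p hp) (a := 1 / 2) (b := 1 / 2) (by norm_num) (by norm_num)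
      (by norm_num)
    simpa using this
  have hz : z = (α / δ) • p + (β / δ) • q := by
    ext
    · simp only [Prod.fst_add, Prod.smul_fst, smul_eq_mul]
      field_simp
      linarith
    · simp only [Prod.snd_add, Prod.smul_snd, smul_eq_mul]
      field_simp
      linarith
  have h3 : α / δ + β / δ ≤ 1 := by
    rw [← add_div, div_le_one hδ]; exact hsum
  have h4 : 0 ≤ α / δ := by positivity
  have h5 : 0 ≤ β / δ := by positivity
  have := hconv.sum_mem (t := Finset.univ)
    (w := ![α / δ, β / δ, 1 - α / δ - β / δ]) (z := ![p, q, 0])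
    (by intro i _; fin_cases i <;> simp <;> linarith)
    (by simp [Fin.sum_univ_three])
    (by intro i _; fin_cases i <;> simp [hp, hq, h0])
  rw [hz]
  simpa [Fin.sum_univ_three] using this

lemma four_mul_bound {a s y : ℝ} (ha : 0 < a) (hs0 : 0 ≤ s) (hs1 : s ≤ 1) (hy0 : 0 ≤ y)
    (hy1 : y ≤ 1 / 2) (h1 : (1 - s) + y * (4 * s - 3) < 0) (h2 : s + a - 4 * a * s < 0) :
    2 - 3 * a - 3 * y + 4 * a * y ≤ 0 := by
  have hA : 0 < 4 * a - 1 := by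
    by_contra hcon
    nlinarith
  have hY : 0 < 4 * y - 1 := by
    by_contra hcon
    nlinarith
  have h3 : a * (4 * y - 1) < (3 * y - 1) * (4 * a - 1) := by nlinarith
  by_contra! hcon
  obtain ⟨A, rfl⟩ : ∃ A, a = (A + 1) / 4 := ⟨4 * a - 1, by ring⟩
  obtain ⟨Y, rfl⟩ : ∃ Y, y = (Y + 1) / 4 := ⟨4 * y - 1, by ring⟩
  have hA' : 0 < A := by linarith
  have hY' : 0 < Y := by linarith
  have h4 : Y < A * (2 * Y - 1) := by nlinarith
  have h5 : 0 < 2 * Y - 1 := by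
    by_contra hneg
    nlinarith
  have h6 : A * (2 - Y) < 3 - 2 * Y := by nlinarith
  have h7 : Y * (2 - Y) < A * (2 * Y - 1) * (2 - Y) :=
    mul_lt_mul_of_pos_right h4 (by linarith)
  have h8 : A * (2 - Y) * (2 * Y - 1) < (3 - 2 * Y) * (2 * Y - 1) :=
    mul_lt_mul_of_pos_right h6 h5
  nlinarith [sq_nonneg (Y - 1)]

lemma exists_mem_of_reduced {C : Set (ℝ × ℝ)} (hconv : Convex ℝ C) (hsymm : ∀ c ∈ C, -c ∈ C)
    (hmax : ∀ c ∈ C, c.1 ≤ 1) {y : ℝ} (hy0 : 0 ≤ y) (hy1 : y ≤ 1 / 2)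
    (hp : ((1 : ℝ), y) ∈ C)
    (hwide : ∀ m n : ℤ, (m, n) ≠ 0 → ∃ c ∈ C, 1 ≤ m * c.1 + n * c.2) :
    ∃ m n : ℤ, (m, n) ≠ 0 ∧ ((3 / 4 * m : ℝ), (3 / 4 * n : ℝ)) ∈ C := by
  have he1 : ((3 / 4 : ℝ), (0 : ℝ)) ∈ C →
      ∃ m n : ℤ, (m, n) ≠ 0 ∧ ((3 / 4 * m : ℝ), (3 / 4 * n : ℝ)) ∈ C :=
    fun h => ⟨1, 0, by simp, by simpa using h⟩
  have he2 : ((0 : ℝ), (3 / 4 : ℝ)) ∈ C →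
      ∃ m n : ℤ, (m, n) ≠ 0 ∧ ((3 / 4 * m : ℝ), (3 / 4 * n : ℝ)) ∈ C :=
    fun h => ⟨0, 1, by simp, by simpa using h⟩
  have he12 : ((3 / 4 : ℝ), (3 / 4 : ℝ)) ∈ C →
      ∃ m n : ℤ, (m, n) ≠ 0 ∧ ((3 / 4 * m : ℝ), (3 / 4 * n : ℝ)) ∈ C :=
    fun h => ⟨1, 1, by simp, by simpa using h⟩
  have hmin : ∀ c ∈ C, -1 ≤ c.1 := by
    intro c hc
    have := hmax _ (hsymm c hc)
    simp only [Prod.fst_neg] at this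
    linarith
  obtain ⟨x, hx0, hx1, hq⟩ : ∃ x : ℝ, -1 ≤ x ∧ x ≤ 1 ∧ (x, (1 : ℝ)) ∈ C := by
    obtain ⟨c, hc, hc1⟩ := hwide 0 1 (by simp)
    norm_num at hc1
    have hmem : (c.1 / c.2, (1 : ℝ)) ∈ C :=
      mem_of_combination hconv hsymm hc hc (α := 1) (β := 0) (δ := c.2) (by norm_num)
        (by norm_num) (by linarith) (by linarith) (by simp; field_simp) (by simp)
    exact ⟨c.1 / c.2, hmin _ hmem, hmax _ hmem, hmem⟩
  obtain ⟨s, hs1, hr⟩ : ∃ s : ℝ, s ≤ 1 ∧ (s, s - 1) ∈ C := by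
    obtain ⟨c, hc, hc1⟩ := hwide 1 (-1) (by simp)
    norm_num at hc1
    have hpos : 0 < c.1 - c.2 := by linarith
    have hmem : (c.1 / (c.1 - c.2), c.1 / (c.1 - c.2) - 1) ∈ C :=
      mem_of_combination hconv hsymm hc hc (α := 1) (β := 0) (δ := c.1 - c.2) (by norm_num)
        (by norm_num) hpos (by linarith) (by simp; field_simp) (by simp; field_simp; ring)
    exact ⟨_, hmax _ hmem, hmem⟩
  rcases le_or_gt x 0 with hx | hx
  · obtain ⟨a, rfl⟩ : ∃ a, x = -a := ⟨-x, by ring⟩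
    have ha : 0 ≤ a := by linarith
    have hay : 0 ≤ a * y := mul_nonneg ha hy0
    rcases le_or_gt a (1 / 3) with h | h
    · refine he2 (mem_of_combination hconv hsymm hp hq (α := 3 / 4 * a) (β := 3 / 4)
        (δ := 1 + a * y) (by positivity) (by norm_num) (by positivity) ?_ ?_ ?_)
      · linarith
      · dsimp only; ring
      · dsimp only; ring
    · refine he1 (mem_of_combination hconv hsymm hp (hsymm _ hq) (α := 3 / 4) (β := 3 / 4 * y)
        (δ := 1 + a * y) (by norm_num) (by positivity) (by positivity) ?_ ?_ ?_)
      · nlinarith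
      · simp only [Prod.fst_neg]; ring
      · simp only [Prod.snd_neg]; ring
  · have hxy : x * y ≤ 1 / 2 := by nlinarith
    rcases lt_or_ge s 0 with h | hs0
    · have hsy : -s * y ≤ -s * (1 / 2) := mul_le_mul_of_nonneg_left hy1 (by linarith)
      have hs2 := hmin _ hr
      dsimp only at hs2
      refine he2 (mem_of_combination hconv hsymm (hsymm _ hp) (hsymm _ hr) (α := 3 / 4 * (-s))
        (β := 3 / 4) (δ := 1 - s + s * y) (by linarith) (by norm_num) (by linarith) ?_ ?_ ?_)
      · linarith
      · simp only [Prod.fst_neg]; ring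
      · simp only [Prod.snd_neg]; ring
    rcases hy0.eq_or_lt with h | hypos
    · subst h
      exact he1 (mem_of_combination hconv hsymm hp hp (α := 3 / 4) (β := 0) (δ := 1)
        (by norm_num) (by norm_num) (by norm_num) (by norm_num) (by norm_num) (by norm_num))
    rcases le_or_gt 0 ((1 - s) + y * (4 * s - 3)) with h1 | h1
    · refine he1 (mem_of_combination hconv hsymm hp hr (α := 3 / 4 * (1 - s)) (β := 3 / 4 * y)
        (δ := 1 - s + y * s) (by linarith) (by linarith) ?_ ?_ ?_ ?_)
      · nlinarith
      · linarith
      · dsimp only; ring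
      · dsimp only; ring
    rcases le_or_gt 0 (s + x - 4 * x * s) with h2 | h2
    · refine he2 (mem_of_combination hconv hsymm hq (hsymm _ hr) (α := 3 / 4 * s)
        (β := 3 / 4 * x) (δ := s + x * (1 - s)) (by linarith) (by linarith) ?_ ?_ ?_ ?_)
      · nlinarith
      · linarith
      · simp only [Prod.fst_neg]; ring
      · simp only [Prod.snd_neg]; ring
    have h3 := four_mul_bound hx hs0 hs1 hy0 hy1 h1 h2
    refine he12 (mem_of_combination hconv hsymm hp hq (α := 3 / 4 * (1 - x))
      (β := 3 / 4 * (1 - y)) (δ := 1 - x * y) (by linarith) (by linarith) (by linarith) ?_ ?_ ?_)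
    · linarith
    · dsimp only; ring
    · dsimp only; ring

/-- The linear endomorphism of the plane with matrix rows `(a, b)` and `(c, d)`. -/
def planeMap (a b c d : ℝ) : (ℝ × ℝ) →ₗ[ℝ] (ℝ × ℝ) where
  toFun z := (a * z.1 + b * z.2, c * z.1 + d * z.2)
  map_add' x y := by ext <;> simp <;> ring
  map_smul' t x := by ext <;> simp <;> ring

/-- The preimage of a set of width at least one under an integral linear map `N`
with integral inverse `M` again has width at least one. -/
lemma wide_preimage {C : Set (ℝ × ℝ)}
    (hwide : ∀ m n : ℤ, (m, n) ≠ 0 → ∃ c ∈ C, 1 ≤ m * c.1 + n * c.2)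
    {a b c d e : ℤ} (he : e * (a * d - b * c) = 1) :
    ∀ m n : ℤ, (m, n) ≠ 0 →
      ∃ z ∈ planeMap (e * d) (-(e * b)) (-(e * c)) (e * a) ⁻¹' C, 1 ≤ m * z.1 + n * z.2 := by
  intro m n hmn
  obtain ⟨z, hz, hz1⟩ := hwide (m * a + n * c) (m * b + n * d) (by
    intro h
    simp only [Prod.mk_eq_zero] at h
    obtain ⟨h1, h2⟩ := h
    apply hmn
    simp only [Prod.mk_eq_zero]
    constructor
    · linear_combination -m * he + e * d * h1 - e * c * h2
    · linear_combination -n * he - e * b * h1 + e * a * h2)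
  have heR : (e : ℝ) * (a * d - b * c) = 1 := by exact_mod_cast he
  refine ⟨(a * z.1 + b * z.2, c * z.1 + d * z.2), ?_, ?_⟩
  · have : planeMap (e * d) (-(e * b)) (-(e * c)) (e * a) (a * z.1 + b * z.2, c * z.1 + d * z.2)
        = z := by
      ext
      · simp only [planeMap, LinearMap.coe_mk, AddHom.coe_mk]
        linear_combination z.1 * heR
      · simp only [planeMap, LinearMap.coe_mk, AddHom.coe_mk]
        linear_combination z.2 * heR
    rw [Set.mem_preimage, this]
    exact hz
  · push_cast at hz1
    dsimp only
    linarith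

lemma exists_mem_of_planeMap_preimage {C : Set (ℝ × ℝ)} {a b c d e : ℤ}
    (he : e * (a * d - b * c) = 1)
    (h : ∃ m n : ℤ, (m, n) ≠ 0 ∧ ((3 / 4 * m : ℝ), (3 / 4 * n : ℝ)) ∈
      planeMap (e * d) (-(e * b)) (-(e * c)) (e * a) ⁻¹' C) :
    ∃ m n : ℤ, (m, n) ≠ 0 ∧ ((3 / 4 * m : ℝ), (3 / 4 * n : ℝ)) ∈ C := by
  obtain ⟨m, n, hmn, hmem⟩ := h
  refine ⟨e * (d * m - b * n), e * (a * n - c * m), ?_, ?_⟩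
  · intro h
    simp only [Prod.mk_eq_zero] at h
    obtain ⟨h1, h2⟩ := h
    apply hmn
    simp only [Prod.mk_eq_zero]
    constructor
    · linear_combination -m * he + a * h1 + b * h2
    · linear_combination -n * he + c * h1 + d * h2
  · have heq : planeMap (e * d) (-(e * b)) (-(e * c)) (e * a) ((3 / 4 * m : ℝ), (3 / 4 * n : ℝ))
        = ((3 / 4 * (e * (d * m - b * n) : ℤ) : ℝ), (3 / 4 * (e * (a * n - c * m) : ℤ) : ℝ)) := by
      ext
      · simp only [planeMap, LinearMap.coe_mk, AddHom.coe_mk]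
        push_cast; ring
      · simp only [planeMap, LinearMap.coe_mk, AddHom.coe_mk]
        push_cast; ring
    rw [Set.mem_preimage, heq] at hmem
    exact hmem

lemma neg_mem_linear_preimage {C : Set (ℝ × ℝ)} (hsymm : ∀ c ∈ C, -c ∈ C)
    (f : (ℝ × ℝ) →ₗ[ℝ] (ℝ × ℝ)) : ∀ c ∈ f ⁻¹' C, -c ∈ f ⁻¹' C := by
  intro c hc
  rw [Set.mem_preimage, map_neg]
  exact hsymm _ hc

lemma exists_mem_of_fst_le {C : Set (ℝ × ℝ)} (hconv : Convex ℝ C) (hsymm : ∀ c ∈ C, -c ∈ C)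
    (hmax : ∀ c ∈ C, c.1 ≤ 1)
    (hwide : ∀ m n : ℤ, (m, n) ≠ 0 → ∃ c ∈ C, 1 ≤ m * c.1 + n * c.2) :
    ∃ m n : ℤ, (m, n) ≠ 0 ∧ ((3 / 4 * m : ℝ), (3 / 4 * n : ℝ)) ∈ C := by
  obtain ⟨y, hp⟩ : ∃ y : ℝ, ((1 : ℝ), y) ∈ C := by
    obtain ⟨c, hc, hc1⟩ := hwide 1 0 (by simp)
    norm_num at hc1
    have : c.1 = 1 := le_antisymm (hmax c hc) hc1
    exact ⟨c.2, by rw [← this]; exact hc⟩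
  have hround := abs_sub_round y
  obtain ⟨e, he, hey⟩ : ∃ e : ℤ, e * e = 1 ∧ (e : ℝ) * (y - round y) = |y - round y| := by
    rcases abs_cases (y - round y) with h | h
    · exact ⟨1, by norm_num, by rw [h.1]; push_cast; ring⟩
    · exact ⟨-1, by norm_num, by rw [h.1]; push_cast; ring⟩
  have heR : (e : ℝ) * e = 1 := by exact_mod_cast he
  have hdet : e * (1 * e - 0 * (-(e * round y))) = 1 := by linear_combination he
  refine exists_mem_of_planeMap_preimage hdet (exists_mem_of_reduced
    (hconv.linear_preimage _) (neg_mem_linear_preimage hsymm _) ?_ (abs_nonneg (y - round y)) hround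
    ?_ (wide_preimage hwide hdet))
  · intro c hc
    have := hmax _ hc
    simp only [planeMap, LinearMap.coe_mk, AddHom.coe_mk] at this
    push_cast at this
    linear_combination this - c.1 * heR
  · rw [Set.mem_preimage, ← hey]
    convert hp using 1
    ext
    · simp only [planeMap, LinearMap.coe_mk, AddHom.coe_mk]
      push_cast
      linear_combination heR
    · simp only [planeMap, LinearMap.coe_mk, AddHom.coe_mk]
      push_cast
      linear_combination y * heR

/-- A symmetric convex set whose lattice half-width is one contains a nonzero point of
`(3 / 4) ℤ²`. -/
lemma exists_mem_of_width_eq_one {C : Set (ℝ × ℝ)} (hconv : Convex ℝ C)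
    (hsymm : ∀ c ∈ C, -c ∈ C) {A B : ℤ} (hAB : (A, B) ≠ 0)
    (hmax : ∀ c ∈ C, A * c.1 + B * c.2 ≤ 1)
    (hwide : ∀ m n : ℤ, (m, n) ≠ 0 → ∃ c ∈ C, 1 ≤ m * c.1 + n * c.2) :
    ∃ m n : ℤ, (m, n) ≠ 0 ∧ ((3 / 4 * m : ℝ), (3 / 4 * n : ℝ)) ∈ C := by
  have hgpos : 0 < Int.gcd A B := by
    rw [Int.gcd_pos_iff]
    by_contra! h
    exact hAB (by simp [h.1, h.2])
  obtain ⟨A', B', hcop, hA, hB⟩ := Int.exists_gcd_one hgpos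
  have hg : Int.gcd A B = 1 := by
    obtain ⟨c, hc, hc1⟩ := hwide A' B' (by
      intro h
      simp only [Prod.mk_eq_zero] at h
      simp [h.1, h.2] at hcop)
    have h1 := hmax c hc
    have hAR : (A : ℝ) = A' * (Int.gcd A B : ℕ) := by exact_mod_cast hA
    have hBR : (B : ℝ) = B' * (Int.gcd A B : ℕ) := by exact_mod_cast hB
    rw [hAR, hBR] at h1
    by_contra hne
    have h2 : (2 : ℝ) ≤ (Int.gcd A B : ℕ) := by exact_mod_cast (by omega : 2 ≤ Int.gcd A B)
    nlinarith
  have hdet : 1 * (A * Int.gcdA A B - B * (-Int.gcdB A B)) = 1 := by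
    have := Int.gcd_eq_gcd_ab A B
    rw [hg] at this
    push_cast at this
    linarith
  have hdetR : (A : ℝ) * Int.gcdA A B + B * Int.gcdB A B = 1 := by
    exact_mod_cast (by linarith : A * Int.gcdA A B + B * Int.gcdB A B = 1)
  refine exists_mem_of_planeMap_preimage hdet (exists_mem_of_fst_le
    (hconv.linear_preimage _) (neg_mem_linear_preimage hsymm _) ?_ (wide_preimage hwide hdet))
  intro c hc
  have := hmax _ hc
  simp only [planeMap, LinearMap.coe_mk, AddHom.coe_mk] at this
  push_cast at this
  linear_combination this - c.1 * hdetR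

lemma exists_perturbation_of_notMem_extremePoints {E : Type*} [AddCommGroup E] [Module ℝ E]
    {K : Set E} (hK : Convex ℝ K) {x : E} (hx : x ∈ K) (hext : x ∉ K.extremePoints ℝ) :
    ∃ δ : E, δ ≠ 0 ∧ ∀ t : ℝ, |t| ≤ 1 → x + t • δ ∈ K := by
  rw [mem_extremePoints] at hext
  push Not at hext
  obtain ⟨x₁, h₁, x₂, h₂, ⟨a, b, ha, hb, hab, rfl⟩, hne⟩ := hext hx
  have hx12 : x₁ ≠ x₂ := by
    rintro rfl
    have h : a • x₁ + b • x₁ = x₁ := by rw [← add_smul, hab, one_smul]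
    exact hne h.symm h.symm
  have hm : 0 < min a b := lt_min ha hb
  refine ⟨min a b • (x₁ - x₂), smul_ne_zero hm.ne' (sub_ne_zero.2 hx12), fun t ht => ?_⟩
  have ht' := abs_le.1 ht
  have key : a • x₁ + b • x₂ + t • min a b • (x₁ - x₂)
      = (a + t * min a b) • x₁ + (b - t * min a b) • x₂ := by module
  rw [key]
  refine hK h₁ h₂ ?_ ?_ (by linarith)
  · nlinarith [min_le_left a b]
  · nlinarith [min_le_right a b]

lemma exists_small_relation (α β : ℝ) :
    ∃ s t : ℝ, |s| ≤ 1 ∧ |t| ≤ 1 ∧ (s ≠ 0 ∨ t ≠ 0) ∧ s * α = t * β := by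
  rcases le_total |α| |β| with h | h
  · by_cases hβ : β = 0
    · subst hβ
      have : α = 0 := by simpa using h
      exact ⟨1, 0, by simp, by simp, by simp, by simp [this]⟩
    · refine ⟨1, α / β, by simp, ?_, by simp, by field_simp⟩
      rw [abs_div]
      exact div_le_one_of_le₀ h (abs_nonneg _)
  · by_cases hα : α = 0
    · subst hα
      have : β = 0 := by simpa using h
      exact ⟨1, 0, by simp, by simp, by simp, by simp⟩
    · refine ⟨β / α, 1, ?_, by simp, by simp, by field_simp⟩
      rw [abs_div]
      exact div_le_one_of_le₀ h (abs_nonneg _)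

/-- Among the longest chords of a compact convex set in a given direction (the kernel of `ν`,
with length measured by `φ`) there is one having an extreme point as an endpoint. -/
lemma exists_longest_chord_extremePoint {K : Set (ℝ × ℝ)} (hK : IsCompact K) (hconv : Convex ℝ K)
    (ν φ : (ℝ × ℝ) →L[ℝ] ℝ) {x₀ y₀ : ℝ × ℝ} (hx₀ : x₀ ∈ K) (hy₀ : y₀ ∈ K) (hν : ν x₀ = ν y₀) :
    ∃ x ∈ K, ∃ y ∈ K, ν x = ν y ∧ φ x₀ - φ y₀ ≤ φ x - φ y ∧
      (x ∈ K.extremePoints ℝ ∨ y ∈ K.extremePoints ℝ) := by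
  let P : Set ((ℝ × ℝ) × (ℝ × ℝ)) := (K ×ˢ K) ∩ {z | ν z.1 = ν z.2}
  have hP : IsCompact P := (hK.prod hK).inter_right
    (isClosed_eq (by fun_prop) (by fun_prop))
  obtain ⟨m, hmP, hm⟩ := hP.exists_isMaxOn ⟨(x₀, y₀), ⟨hx₀, hy₀⟩, hν⟩
    (f := fun z => φ z.1 - φ z.2) (by fun_prop)
  let F := P ∩ {z | φ m.1 - φ m.2 ≤ φ z.1 - φ z.2}
  have hF : IsCompact F := hP.inter_right (isClosed_le (by fun_prop) (by fun_prop))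
  obtain ⟨⟨x, y⟩, hxy⟩ := hF.extremePoints_nonempty ⟨m, hmP, le_refl (φ m.1 - φ m.2)⟩
  have hxyF : (x, y) ∈ F := hxy.1
  obtain ⟨⟨⟨hx, hy⟩, hνxy⟩, hφ⟩ := hxyF
  simp only [Set.mem_ofPred_eq] at hx hy hνxy hφ
  have h0 : φ x₀ - φ y₀ ≤ φ m.1 - φ m.2 := hm (show (x₀, y₀) ∈ P from ⟨⟨hx₀, hy₀⟩, hν⟩)
  refine ⟨x, hx, y, hy, hνxy, h0.trans hφ, ?_⟩
  by_contra! hcon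
  obtain ⟨dx, hdx, hxK⟩ := exists_perturbation_of_notMem_extremePoints hconv hx hcon.1
  obtain ⟨dy, hdy, hyK⟩ := exists_perturbation_of_notMem_extremePoints hconv hy hcon.2
  obtain ⟨s, t, hs, ht, hst, hrel⟩ := exists_small_relation (ν dx) (ν dy)
  have hP1 : (x + s • dx, y + t • dy) ∈ P := ⟨⟨hxK s hs, hyK t ht⟩, by simp [hνxy, hrel]⟩
  have hP2 : (x + (-s) • dx, y + (-t) • dy) ∈ P :=
    ⟨⟨hxK (-s) (by simpa using hs), hyK (-t) (by simpa using ht)⟩, by simp [hνxy, hrel]⟩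
  have h1 : φ (x + s • dx) - φ (y + t • dy) ≤ φ m.1 - φ m.2 := hm hP1
  have h2 : φ (x + (-s) • dx) - φ (y + (-t) • dy) ≤ φ m.1 - φ m.2 := hm hP2
  have hF1 : (x + s • dx, y + t • dy) ∈ F := by
    refine ⟨hP1, ?_⟩
    simp only [Set.mem_ofPred_eq]
    simp only [map_add, map_smul, smul_eq_mul] at h1 h2 ⊢
    linarith
  have hF2 : (x + (-s) • dx, y + (-t) • dy) ∈ F := by
    refine ⟨hP2, ?_⟩
    simp only [Set.mem_ofPred_eq]
    simp only [map_add, map_smul, smul_eq_mul] at h1 h2 ⊢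
    linarith
  have heq := hxy.2 hF1 hF2 ⟨1 / 2, 1 / 2, by norm_num, by norm_num, by norm_num, by
    ext <;> simp <;> ring⟩
  simp only [Prod.mk.injEq, add_eq_left, smul_eq_zero, hdx, hdy, or_false] at heq
  tauto

/-- The integer points `z, z + v, …, z + D v` of a digital convex set containing both ends lie on
a common line. -/
lemma succ_le_ncard_line {S : Set (ℤ × ℤ)} (hfin : S.Finite) (hdc : DigitalConvex S)
    {z v : ℤ × ℤ} (hv : v ≠ 0) (hz : z ∈ S) {D : ℕ} {t : ℝ} (hDt : D ≤ t)
    (hmem : toR2 z + t • toR2 v ∈ convexHull ℝ (toR2 '' S)) :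
    D + 1 ≤ Set.ncard {x ∈ S | ∃ r : ℝ, toR2 x = toR2 z + r • toR2 v} := by
  let f : ℕ → ℤ × ℤ := fun i => z + (i : ℤ) • v
  have hf : Function.Injective f := by
    intro i j hij
    simp only [f, add_right_inj] at hij
    have := smul_left_injective ℤ hv hij
    exact_mod_cast this
  have hfR : ∀ i, toR2 (f i) = toR2 z + (i : ℝ) • toR2 v := by
    intro i
    ext <;> simp [f, toR2]
  have hsub : (((Finset.range (D + 1)).image f : Finset (ℤ × ℤ)) : Set (ℤ × ℤ)) ⊆
      {x ∈ S | ∃ r : ℝ, toR2 x = toR2 z + r • toR2 v} := by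
    intro x hx
    simp only [Finset.coe_image, Set.mem_image, Finset.mem_coe, Finset.mem_range] at hx
    obtain ⟨i, hi, rfl⟩ := hx
    refine ⟨?_, i, hfR i⟩
    rw [← hdc]
    simp only [Set.mem_ofPred_eq]
    rw [hfR]
    have hit : (i : ℝ) ≤ t := le_trans (by exact_mod_cast (by omega : i ≤ D)) hDt
    have hi0 : (0 : ℝ) ≤ i := Nat.cast_nonneg i
    have hz' : toR2 z ∈ convexHull ℝ (toR2 '' S) := subset_convexHull ℝ _ ⟨z, hz, rfl⟩
    rcases (hi0.trans hit).eq_or_lt with h | h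
    · have : (i : ℝ) = 0 := by linarith
      rw [this, zero_smul, add_zero]
      exact hz'
    · have := (convex_convexHull ℝ (toR2 '' S)).add_smul_mem hz' hmem
        (t := i / t) ⟨by positivity, (div_le_one h).2 hit⟩
      rwa [smul_smul, div_mul_cancel₀ _ h.ne'] at this
  have hcard := Set.ncard_le_ncard hsub (hfin.subset (Set.sep_subset _ _))
  rwa [Set.ncard_coe_finset, Finset.card_image_of_injective _ hf, Finset.card_range] at hcard

lemma bddAbove_line_ncard {S : Set (ℤ × ℤ)} (hfin : S.Finite) :
    BddAbove {m : ℕ | ∃ a v : ℝ × ℝ, v ≠ 0 ∧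
      m = Set.ncard {z ∈ S | ∃ t : ℝ, toR2 z = a + t • v}} := by
  refine ⟨S.ncard, ?_⟩
  rintro _ ⟨a, v, _, rfl⟩
  exact Set.ncard_le_ncard (Set.sep_subset _ _) hfin

lemma toR2_ne_zero {v : ℤ × ℤ} (hv : v ≠ 0) : toR2 v ≠ 0 := by
  intro h
  apply hv
  simp only [toR2, Prod.mk_eq_zero, Int.cast_eq_zero] at h
  exact Prod.ext h.1 h.2

/-- A chord of `conv S` of length `D` in a lattice direction forces a line with `D + 1` points. -/
lemma exists_succ_le_ncard_line {S : Set (ℤ × ℤ)} (hfin : S.Finite) (hdc : DigitalConvex S)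
    {v : ℤ × ℤ} (hv : v ≠ 0) {D : ℕ} {x₀ y₀ : ℝ × ℝ} (hx₀ : x₀ ∈ convexHull ℝ (toR2 '' S))
    (hy₀ : y₀ ∈ convexHull ℝ (toR2 '' S)) {t₀ : ℝ} (hD : D ≤ t₀) (hxy : x₀ = y₀ + t₀ • toR2 v) :
    ∃ a w : ℝ × ℝ, w ≠ 0 ∧ D + 1 ≤ Set.ncard {x ∈ S | ∃ r : ℝ, toR2 x = a + r • w} := by
  have hK : IsCompact (convexHull ℝ (toR2 '' S)) := (hfin.image _).isCompact_convexHull ℝ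
  have hvR := toR2_ne_zero hv
  set V := toR2 v with hV
  have hnorm : 0 < V.1 * V.1 + V.2 * V.2 := by
    rcases eq_or_ne V.1 0 with h | h
    · have : V.2 ≠ 0 := fun h' => hvR (Prod.ext h h')
      exact add_pos_of_nonneg_of_pos (mul_self_nonneg _) (mul_self_pos.2 this)
    · exact add_pos_of_pos_of_nonneg (mul_self_pos.2 h) (mul_self_nonneg _)
  let ν : (ℝ × ℝ) →L[ℝ] ℝ :=
    V.2 • ContinuousLinearMap.fst ℝ ℝ ℝ - V.1 • ContinuousLinearMap.snd ℝ ℝ ℝ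
  let φ : (ℝ × ℝ) →L[ℝ] ℝ :=
    V.1 • ContinuousLinearMap.fst ℝ ℝ ℝ + V.2 • ContinuousLinearMap.snd ℝ ℝ ℝ
  have hνe : ∀ z, ν z = V.2 * z.1 - V.1 * z.2 := fun z => by simp [ν]
  have hφe : ∀ z, φ z = V.1 * z.1 + V.2 * z.2 := fun z => by simp [φ]
  obtain ⟨x, hx, y, hy, h1, h2, h3⟩ := exists_longest_chord_extremePoint hK (convex_convexHull ℝ _)
    ν φ hx₀ hy₀ (by rw [hxy, hνe, hνe]; simp; ring)
  rw [hνe, hνe] at h1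
  rw [hφe, hφe, hφe, hφe, hxy] at h2
  simp only [Prod.fst_add, Prod.snd_add, Prod.smul_fst, Prod.smul_snd, smul_eq_mul] at h2
  let t := (V.1 * (x.1 - y.1) + V.2 * (x.2 - y.2)) / (V.1 * V.1 + V.2 * V.2)
  have htN : t * (V.1 * V.1 + V.2 * V.2) = V.1 * (x.1 - y.1) + V.2 * (x.2 - y.2) :=
    div_mul_cancel₀ _ hnorm.ne'
  have ht : t₀ ≤ t := by
    rw [le_div_iff₀ hnorm]
    linarith
  have hxy' : x = y + t • V := by
    ext
    · simp only [Prod.fst_add, Prod.smul_fst, smul_eq_mul]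
      apply mul_right_cancel₀ hnorm.ne'
      linear_combination V.2 * h1 - V.1 * htN
    · simp only [Prod.snd_add, Prod.smul_snd, smul_eq_mul]
      apply mul_right_cancel₀ hnorm.ne'
      linear_combination -V.1 * h1 - V.2 * htN
  rcases h3 with h3 | h3
  · obtain ⟨z, hz, rfl⟩ := extremePoints_convexHull_subset h3
    have hneg : toR2 (-v) = -V := by ext <;> simp [hV, toR2]
    refine ⟨toR2 z, toR2 (-v), toR2_ne_zero (neg_ne_zero.2 hv),
      succ_le_ncard_line hfin hdc (neg_ne_zero.2 hv) hz (hD.trans ht) ?_⟩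
    have : toR2 z + t • toR2 (-v) = y := by rw [hxy', hneg]; module
    rwa [this]
  · obtain ⟨z, hz, rfl⟩ := extremePoints_convexHull_subset h3
    exact ⟨toR2 z, V, hvR, succ_le_ncard_line hfin hdc hv hz (hD.trans ht) (by rwa [hxy'] at hx)⟩

lemma finite_differences {S : Set (ℤ × ℤ)} (hfin : S.Finite) (u : ℤ × ℤ) :
    {d : ℤ | ∃ a ∈ S, ∃ b ∈ S, d = u.1 * (b.1 - a.1) + u.2 * (b.2 - a.2)}.Finite := by
  refine ((hfin.prod hfin).image
    (fun q => u.1 * (q.2.1 - q.1.1) + u.2 * (q.2.2 - q.1.2))).subset ?_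
  rintro d ⟨a, ha, b, hb, rfl⟩
  exact ⟨(a, b), ⟨ha, hb⟩, rfl⟩

lemma latticeWidth_spec {S : Set (ℤ × ℤ)} (hfin : S.Finite) (hne : S.Nonempty) :
    (∀ u : ℤ × ℤ, u ≠ 0 → ∃ a ∈ S, ∃ b ∈ S,
      latticeWidth S ≤ u.1 * (b.1 - a.1) + u.2 * (b.2 - a.2)) ∧
    ∃ u : ℤ × ℤ, u ≠ 0 ∧ ∀ a ∈ S, ∀ b ∈ S,
      u.1 * (b.1 - a.1) + u.2 * (b.2 - a.2) ≤ latticeWidth S := by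
  obtain ⟨z, hz⟩ := hne
  have hbdd : BddBelow {w : ℤ | ∃ u : ℤ × ℤ, u ≠ 0 ∧
      w = sSup {d : ℤ | ∃ a ∈ S, ∃ b ∈ S, d = u.1 * (b.1 - a.1) + u.2 * (b.2 - a.2)}} := by
    refine ⟨0, ?_⟩
    rintro _ ⟨u, _, rfl⟩
    exact le_csSup (a := 0) (finite_differences hfin u).bddAbove ⟨z, hz, z, hz, by ring⟩
  constructor
  · intro u hu
    obtain ⟨a, ha, b, hb, h⟩ := Int.csSup_mem
      (s := {d : ℤ | ∃ a ∈ S, ∃ b ∈ S, d = u.1 * (b.1 - a.1) + u.2 * (b.2 - a.2)})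
      ⟨_, z, hz, z, hz, rfl⟩ (finite_differences hfin u).bddAbove
    exact ⟨a, ha, b, hb, h ▸ csInf_le hbdd ⟨u, hu, rfl⟩⟩
  · have hnonempty : {w : ℤ | ∃ u : ℤ × ℤ, u ≠ 0 ∧ w = sSup {d : ℤ | ∃ a ∈ S, ∃ b ∈ S,
        d = u.1 * (b.1 - a.1) + u.2 * (b.2 - a.2)}}.Nonempty := ⟨_, (1, 0), by simp, rfl⟩
    obtain ⟨u, hu, h⟩ := Int.csInf_mem hnonempty hbdd
    refine ⟨u, hu, fun a ha b hb => ?_⟩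
    rw [latticeWidth, h]
    exact le_csSup (finite_differences hfin u).bddAbove ⟨a, ha, b, hb, rfl⟩

open scoped Pointwise in
/-- The difference body of `conv S` contains a chord vector `(3 w / 4) v` with `v` integral,
where `w` is the lattice width. -/
lemma exists_chord_of_latticeWidth_pos {S : Set (ℤ × ℤ)} (hfin : S.Finite) (hne : S.Nonempty)
    (hw : 0 < latticeWidth S) :
    ∃ v : ℤ × ℤ, v ≠ 0 ∧ ∃ x ∈ convexHull ℝ (toR2 '' S), ∃ y ∈ convexHull ℝ (toR2 '' S),
      x = y + (3 / 4 * (latticeWidth S : ℝ)) • toR2 v := by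
  obtain ⟨hwide, u, hu, hmax⟩ := latticeWidth_spec hfin hne
  set w := latticeWidth S
  have hwR : (0 : ℝ) < w := by exact_mod_cast hw
  set K := convexHull ℝ (toR2 '' S) with hKdef
  have hK : Convex ℝ K := convex_convexHull ℝ _
  have hbound : ∀ c ∈ K - K, u.1 * c.1 + u.2 * c.2 ≤ (w : ℝ) := by
    have hsub : K - K = convexHull ℝ (toR2 '' S - toR2 '' S) := (convexHull_sub _ _).symm
    rw [hsub]
    have hlin : IsLinearMap ℝ (fun c : ℝ × ℝ => (u.1 : ℝ) * c.1 + u.2 * c.2) :=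
      ⟨fun x y => by simp; ring, fun t x => by simp; ring⟩
    refine fun c hc => convexHull_min ?_ (convex_halfSpace_le hlin (w : ℝ)) hc
    rintro _ ⟨_, ⟨b, hb, rfl⟩, _, ⟨a, ha, rfl⟩, rfl⟩
    simp only [Set.mem_ofPred_eq, toR2, Prod.fst_sub, Prod.snd_sub]
    exact_mod_cast hmax a ha b hb
  have hscale : Convex ℝ ((fun z : ℝ × ℝ => (w : ℝ) • z) ⁻¹' (K - K)) :=
    (hK.sub hK).linear_preimage (LinearMap.lsmul ℝ (ℝ × ℝ) (w : ℝ))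
  obtain ⟨m, n, hmn, x, hx, y, hy, hxy⟩ := exists_mem_of_width_eq_one hscale (A := u.1) (B := u.2)
    (by
      rintro c ⟨x, hx, y, hy, h⟩
      refine ⟨y, hy, x, hx, ?_⟩
      simp only [smul_neg] at h ⊢
      rw [← h, neg_sub]) hu
    (by
      intro c hc
      have := hbound _ hc
      simp only [Prod.smul_fst, Prod.smul_snd, smul_eq_mul] at this
      nlinarith)
    (by
      intro m n hmn
      obtain ⟨a, ha, b, hb, hab⟩ := hwide (m, n) hmn
      refine ⟨(w : ℝ)⁻¹ • (toR2 b - toR2 a), ?_, ?_⟩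
      · rw [Set.mem_preimage, smul_inv_smul₀ hwR.ne']
        exact Set.sub_mem_sub (subset_convexHull ℝ _ ⟨b, hb, rfl⟩)
          (subset_convexHull ℝ _ ⟨a, ha, rfl⟩)
      · have : (w : ℝ) ≤ m * (b.1 - a.1) + n * (b.2 - a.2) := by exact_mod_cast hab
        simp only [toR2, Prod.smul_fst, Prod.smul_snd, Prod.fst_sub, Prod.snd_sub, smul_eq_mul]
        field_simp
        exact this)
  refine ⟨(m, n), hmn, x, hx, y, hy, ?_⟩
  have hxy' : x - y = (w : ℝ) • ((3 / 4 * m : ℝ), (3 / 4 * n : ℝ)) := hxy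
  rw [← sub_eq_iff_eq_add', hxy']
  ext <;> simp [toR2] <;> ring

theorem width_le_diameter_bound
    (S : Set (ℤ × ℤ)) (hfin : S.Finite) (hne : S.Nonempty)
    (hdc : DigitalConvex S) :
    latticeWidth S ≤ ⌊(4 : ℚ) / 3 * (latticeDiameter S : ℚ)⌋ + 1 := by
  set D := sSup {m : ℕ | ∃ a v : ℝ × ℝ, v ≠ 0 ∧
    m = Set.ncard {z ∈ S | ∃ t : ℝ, toR2 z = a + t • v}} with hD
  have hline : ∀ a v : ℝ × ℝ, v ≠ 0 →
      Set.ncard {z ∈ S | ∃ t : ℝ, toR2 z = a + t • v} ≤ D :=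
    fun a v hv => le_csSup (bddAbove_line_ncard hfin) ⟨a, v, hv, rfl⟩
  have hDpos : 1 ≤ D := by
    obtain ⟨z, hz⟩ := hne
    refine le_trans ?_ (hline (toR2 z) (1, 0) (by simp))
    rw [Nat.one_le_iff_ne_zero, ← Nat.pos_iff_ne_zero,
      Set.ncard_pos (hfin.subset (Set.sep_subset _ _))]
    exact ⟨z, hz, 0, by simp⟩
  have key : 3 * latticeWidth S < 4 * (D : ℤ) := by
    by_contra! hcon
    obtain ⟨v, hv, x, hx, y, hy, hxy⟩ := exists_chord_of_latticeWidth_pos hfin hne (by omega)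
    have hDw : (D : ℝ) ≤ 3 / 4 * (latticeWidth S : ℝ) := by
      have : 4 * (D : ℝ) ≤ 3 * (latticeWidth S : ℝ) := by exact_mod_cast hcon
      linarith
    obtain ⟨a, b, hb, hab⟩ := exists_succ_le_ncard_line hfin hdc hv hx hy hDw hxy
    exact absurd (hab.trans (hline a b hb)) (by omega)
  have hd : latticeDiameter S = (D : ℤ) - 1 := rfl
  rw [hd, ← sub_le_iff_le_add, Int.le_floor]
  have : (3 : ℚ) * latticeWidth S + 1 ≤ 4 * (D : ℚ) := by exact_mod_cast key
  push_cast
  linarith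
end

section
/- Let S ⊆ ℤ² be a finite nonempty digital convex set of n points whose lattice width satisfies w(S) ≥ 1. Then n ≥ (3/8)·w(S)² − (1/2)·w(S) + 3 (as an inequality of rational numbers). -/
open scoped Pointwise

/-- The difference body of the convex hull of a set of lattice points. -/
def diffBody (S : Set (ℤ × ℤ)) : Set (ℝ × ℝ) :=
  convexHull ℝ (toR2 '' S) - convexHull ℝ (toR2 '' S)

lemma convex_diffBody (S : Set (ℤ × ℤ)) : Convex ℝ (diffBody S) :=
  (convex_convexHull ℝ _).sub (convex_convexHull ℝ _)

lemma isCompact_diffBody {S : Set (ℤ × ℤ)} (hS : S.Finite) : IsCompact (diffBody S) := by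
  have h := (hS.image toR2).isCompact_convexHull ℝ
  rw [diffBody, sub_eq_add_neg]
  exact h.add h.neg

lemma neg_mem_diffBody {S : Set (ℤ × ℤ)} {z : ℝ × ℝ} (hz : z ∈ diffBody S) :
    -z ∈ diffBody S := by
  obtain ⟨a, ha, b, hb, rfl⟩ := Set.mem_sub.1 hz
  exact Set.mem_sub.2 ⟨b, hb, a, ha, by abel⟩

lemma sub_mem_diffBody {S : Set (ℤ × ℤ)} {a b : ℤ × ℤ} (ha : a ∈ S) (hb : b ∈ S) :
    toR2 (a - b) ∈ diffBody S := by
  refine Set.mem_sub.2 ⟨toR2 a, subset_convexHull ℝ _ ⟨a, ha, rfl⟩,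
    toR2 b, subset_convexHull ℝ _ ⟨b, hb, rfl⟩, ?_⟩
  simp [toR2]

lemma exists_latticeWidth_le {S : Set (ℤ × ℤ)} (hfin : S.Finite)
    (hne : S.Nonempty) {u : ℤ × ℤ} (hu : u ≠ 0) :
    ∃ a ∈ S, ∃ b ∈ S, latticeWidth S ≤ u.1 * (b.1 - a.1) + u.2 * (b.2 - a.2) := by
  have key : ∀ u : ℤ × ℤ, ∃ a ∈ S, ∃ b ∈ S,
      sSup {d : ℤ | ∃ a ∈ S, ∃ b ∈ S, d = u.1 * (b.1 - a.1) + u.2 * (b.2 - a.2)} =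
        u.1 * (b.1 - a.1) + u.2 * (b.2 - a.2) ∧
      0 ≤ u.1 * (b.1 - a.1) + u.2 * (b.2 - a.2) := by
    intro u
    have hf : {d : ℤ | ∃ a ∈ S, ∃ b ∈ S,
        d = u.1 * (b.1 - a.1) + u.2 * (b.2 - a.2)}.Finite := by
      refine ((hfin.prod hfin).image
        (fun p => u.1 * (p.2.1 - p.1.1) + u.2 * (p.2.2 - p.1.2))).subset ?_
      rintro d ⟨a, ha, b, hb, rfl⟩
      exact ⟨(a, b), ⟨ha, hb⟩, rfl⟩
    obtain ⟨c, hc⟩ := hne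
    have h0 : (0 : ℤ) ∈ {d : ℤ | ∃ a ∈ S, ∃ b ∈ S,
        d = u.1 * (b.1 - a.1) + u.2 * (b.2 - a.2)} := ⟨c, hc, c, hc, by ring⟩
    obtain ⟨a, ha, b, hb, h⟩ := Int.csSup_mem ⟨0, h0⟩ hf.bddAbove
    exact ⟨a, ha, b, hb, h, h ▸ le_csSup hf.bddAbove h0⟩
  obtain ⟨a, ha, b, hb, h, -⟩ := key u
  refine ⟨a, ha, b, hb, ?_⟩
  rw [← h]
  refine csInf_le ⟨0, ?_⟩ ⟨u, hu, rfl⟩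
  rintro _ ⟨u', -, rfl⟩
  obtain ⟨a', -, b', -, h', h0⟩ := key u'
  rw [h']
  exact h0

lemma zero_mem_interior_diffBody {S : Set (ℤ × ℤ)} {w : ℤ} (hw : 1 ≤ w)
    (hwd : ∀ u : ℤ × ℤ, u ≠ 0 →
      ∃ a ∈ S, ∃ b ∈ S, w ≤ u.1 * (b.1 - a.1) + u.2 * (b.2 - a.2)) :
    (0 : ℝ × ℝ) ∈ interior (diffBody S) := by
  obtain ⟨a, ha, b, hb, h₁⟩ := hwd (1, 0) (by simp)
  obtain ⟨c, hc, d, hd, h₂⟩ := hwd (-(b.2 - a.2), b.1 - a.1) (by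
    intro h
    simp only [Prod.mk_eq_zero] at h
    simp only [h.2] at h₁
    omega)
  have hp := sub_mem_diffBody hb ha
  have hq := sub_mem_diffBody hd hc
  have hconv := convex_diffBody S
  have hΔ : (1 : ℝ) ≤ -(b.2 - a.2) * (d.1 - c.1) + (b.1 - a.1) * (d.2 - c.2) := by
    have := hw.trans h₂
    exact_mod_cast this
  set p := toR2 (b - a) with hpdef
  set q := toR2 (d - c) with hqdef
  have hp1 : p.1 = b.1 - a.1 := by simp [hpdef, toR2]
  have hp2 : p.2 = b.2 - a.2 := by simp [hpdef, toR2]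
  have hq1 : q.1 = d.1 - c.1 := by simp [hqdef, toR2]
  have hq2 : q.2 = d.2 - c.2 := by simp [hqdef, toR2]
  rw [← hp1, ← hp2, ← hq1, ← hq2] at hΔ
  set Δ : ℝ := -p.2 * q.1 + p.1 * q.2
  have h0 : (0 : ℝ × ℝ) ∈ diffBody S := by
    have := hconv hp (neg_mem_diffBody hp) (a := 1 / 2) (b := 1 / 2)
      (by norm_num) (by norm_num) (by norm_num)
    simpa using this
  have scale : ∀ r ∈ diffBody S, ∀ t : ℝ, |t| ≤ 1 → t • r ∈ diffBody S := by
    intro r hr t ht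
    rw [abs_le] at ht
    have := hconv hr (neg_mem_diffBody hr) (a := (1 + t) / 2) (b := (1 - t) / 2)
      (by linarith) (by linarith) (by ring)
    convert this using 1
    ext <;> simp <;> ring
  rw [mem_interior]
  refine ⟨{z | |z.1 * q.2 - z.2 * q.1| < Δ / 2 ∧ |p.1 * z.2 - p.2 * z.1| < Δ / 2}, ?_, ?_, ?_⟩
  · rintro z ⟨h1, h2⟩
    have e1 := scale p hp (2 * (z.1 * q.2 - z.2 * q.1) / Δ) (by
      rw [abs_div, abs_mul, abs_of_pos (show (0 : ℝ) < Δ by linarith), div_le_one (by linarith),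
        abs_two]
      linarith)
    have e2 := scale q hq (2 * (p.1 * z.2 - p.2 * z.1) / Δ) (by
      rw [abs_div, abs_mul, abs_of_pos (show (0 : ℝ) < Δ by linarith), div_le_one (by linarith),
        abs_two]
      linarith)
    have := hconv e1 e2 (a := 1 / 2) (b := 1 / 2) (by norm_num) (by norm_num) (by norm_num)
    convert this using 1
    have hΔ0 : Δ ≠ 0 := by linarith
    ext
    · simp only [Prod.fst_add, Prod.smul_fst, smul_eq_mul]
      field_simp
      simp only [Δ]; ring
    · simp only [Prod.snd_add, Prod.smul_snd, smul_eq_mul]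
      field_simp
      simp only [Δ]; ring
  · have h1 : Continuous fun z : ℝ × ℝ => |z.1 * q.2 - z.2 * q.1| := by fun_prop
    have h2 : Continuous fun z : ℝ × ℝ => |p.1 * z.2 - p.2 * z.1| := by fun_prop
    exact (isOpen_lt h1 continuous_const).inter (isOpen_lt h2 continuous_const)
  · have : 0 < Δ := by linarith
    simp [this]

/-- A symmetric convex neighbourhood of the origin has a supporting strip through every point
that is not in its interior. -/
lemma exists_supporting_strip {D : Set (ℝ × ℝ)} (hconv : Convex ℝ D)
    (hneg : ∀ z ∈ D, -z ∈ D) (h0 : (0 : ℝ × ℝ) ∈ interior D) {x : ℝ × ℝ}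
    (hx : ∀ c : ℝ, 1 < c → c • x ∉ D) :
    ∃ a b : ℝ, a * x.1 + b * x.2 = 1 ∧ ∀ z ∈ D, |a * z.1 + b * z.2| ≤ 1 := by
  have hxi : x ∉ interior D := by
    intro hxi
    have hcont : ContinuousAt (fun c : ℝ => c • x) 1 := by fun_prop
    have hev : ∀ᶠ c in nhds (1 : ℝ), c • x ∈ D :=
      hcont.eventually (by simpa using mem_interior_iff_mem_nhds.1 hxi)
    obtain ⟨c, hc, hc1⟩ := ((hev.filter_mono nhdsWithin_le_nhds).and
      (self_mem_nhdsWithin (a := (1 : ℝ)) (s := Set.Ioi 1))).exists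
    exact hx c hc1 hc
  obtain ⟨f, hf⟩ := geometric_hahn_banach_open_point hconv.interior isOpen_interior hxi
  have hpos : 0 < f x := by simpa using hf 0 h0
  have hle : ∀ z ∈ D, f z ≤ f x := by
    intro z hz
    have hz' : z ∈ closure (interior D) := by
      rw [hconv.closure_interior_eq_closure_of_nonempty_interior ⟨0, h0⟩]
      exact subset_closure hz
    exact closure_minimal (fun y hy => (hf y hy).le)
      (isClosed_le f.continuous continuous_const) hz'
  have hform : ∀ z : ℝ × ℝ, f (1, 0) / f x * z.1 + f (0, 1) / f x * z.2 = f z / f x := by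
    intro z
    have : z = z.1 • ((1, 0) : ℝ × ℝ) + z.2 • ((0, 1) : ℝ × ℝ) := by ext <;> simp
    conv_rhs => rw [this, map_add, map_smul, map_smul, smul_eq_mul, smul_eq_mul]
    ring
  refine ⟨f (1, 0) / f x, f (0, 1) / f x, ?_, fun z hz => ?_⟩
  · rw [hform, div_self hpos.ne']
  · rw [hform, abs_div, abs_of_pos hpos, div_le_one hpos, abs_le]
    have := hle _ (hneg z hz)
    rw [map_neg] at this
    exact ⟨by linarith, hle z hz⟩

/-- Two strips of equal half-width `ℓ`, in directions `(1, t)` and `(s, 1)` with `s ≤ 0 ≤ t`,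
bound one of the coordinates by `4 / 3 * ℓ`. -/
lemma two_strips_bound {D : Set (ℝ × ℝ)} {ℓ t s : ℝ} (ht : 0 ≤ t) (hs : s ≤ 0)
    (h₁ : ∀ z ∈ D, |z.1 + t * z.2| ≤ ℓ) (h₂ : ∀ z ∈ D, |s * z.1 + z.2| ≤ ℓ) :
    (∀ z ∈ D, z.1 ≤ 4 / 3 * ℓ) ∨ (∀ z ∈ D, z.2 ≤ 4 / 3 * ℓ) := by
  have hst : 0 ≤ t * -s := mul_nonneg ht (by linarith)
  by_cases hx : t * (3 + 4 * s) ≤ 1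
  · left
    intro z hz
    have a₁ := abs_le.1 (h₁ z hz)
    have a₂ := abs_le.1 (h₂ z hz)
    have hℓ : 0 ≤ ℓ := by linarith
    nlinarith [mul_nonneg ht (sub_nonneg.2 a₂.1), mul_nonneg hℓ (sub_nonneg.2 hx),
      mul_nonneg hℓ hst]
  · right
    have hy : -s * (3 - 4 * t) ≤ 1 := by
      by_contra hy
      push Not at hx hy
      nlinarith [sq_nonneg (t + s), sq_nonneg (8 * s + 3), sq_nonneg (8 * t - 3)]
    intro z hz
    have a₁ := abs_le.1 (h₁ z hz)
    have a₂ := abs_le.1 (h₂ z hz)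
    have hℓ : 0 ≤ ℓ := by linarith
    nlinarith [mul_nonneg (neg_nonneg.2 hs) (sub_nonneg.2 a₁.2), mul_nonneg hℓ (sub_nonneg.2 hy),
      mul_nonneg hℓ hst]

lemma three_strips_bound {D : Set (ℝ × ℝ)} {ℓ t s a : ℝ} (hℓ : 0 ≤ ℓ) (ht : 0 ≤ t) (ht1 : t < 1)
    (hs : 0 ≤ s) (hs1 : s ≤ 1) (ha : 0 ≤ a) (ha1 : a ≤ 1)
    (h₁ : ∀ z ∈ D, |z.1 + t * z.2| ≤ ℓ) (h₂ : ∀ z ∈ D, |s * z.1 + z.2| ≤ ℓ)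
    (h₃ : ∀ z ∈ D, |a * z.1 - (1 - a) * z.2| ≤ ℓ) :
    (∀ z ∈ D, z.1 ≤ 4 / 3 * ℓ) ∨ (∀ z ∈ D, z.2 ≤ 4 / 3 * ℓ) ∨
      (∀ z ∈ D, z.1 + z.2 ≤ 4 / 3 * ℓ) := by
  have key : ∀ {c k y : ℝ}, 0 < c → c * y ≤ k * ℓ → 3 * k ≤ 4 * c → y ≤ 4 / 3 * ℓ := by
    intro c k y hc h hk
    by_contra hy
    push Not at hy
    nlinarith [mul_lt_mul_of_pos_left hy hc, mul_nonneg hℓ (sub_nonneg.2 hk)]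
  rcases ht.eq_or_lt with rfl | htpos
  · left
    intro z hz
    have a₁ := abs_le.1 (h₁ z hz)
    linarith
  rcases hs.eq_or_lt with rfl | hspos
  · right; left
    intro z hz
    have a₂ := abs_le.1 (h₂ z hz)
    linarith
  by_cases hx : t * (3 - 4 * a) ≤ 1 - a
  · left
    have hc : 0 < (1 - a) + a * t := by
      rcases ha.eq_or_lt with rfl | hapos
      · simp
      · linarith [mul_pos hapos htpos]
    intro z hz
    have a₁ := abs_le.1 (h₁ z hz)
    have a₃ := abs_le.1 (h₃ z hz)
    refine key (c := (1 - a) + a * t) (k := (1 - a) + t) hc ?_ (by linarith)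
    nlinarith [mul_nonneg ht (sub_nonneg.2 a₃.2), mul_nonneg (sub_nonneg.2 ha1) (sub_nonneg.2 a₁.2)]
  by_cases hy : s * (4 * a - 1) ≤ a
  · right; left
    have hc : 0 < a + (1 - a) * s := by
      rcases ha1.eq_or_lt with rfl | hapos
      · simp
      · linarith [mul_pos (sub_pos.2 hapos) hspos]
    intro z hz
    have a₂ := abs_le.1 (h₂ z hz)
    have a₃ := abs_le.1 (h₃ z hz)
    refine key (c := a + (1 - a) * s) (k := a + s) hc ?_ (by linarith)
    nlinarith [mul_nonneg hs (sub_nonneg.2 a₃.1), mul_nonneg ha (sub_nonneg.2 a₂.2)]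
  right; right
  intro z hz
  have a₁ := abs_le.1 (h₁ z hz)
  have a₂ := abs_le.1 (h₂ z hz)
  have hst : 0 < 1 - s * t := by nlinarith
  refine key (c := 1 - s * t) (k := 2 - s - t) hst ?_ ?_
  · nlinarith [mul_nonneg (sub_nonneg.2 hs1) (sub_nonneg.2 a₁.2),
      mul_nonneg (sub_nonneg.2 ht1.le) (sub_nonneg.2 a₂.2)]
  · push Not at hx hy
    have hP : 0 < 3 - 4 * a := by
      by_contra h
      nlinarith
    have hQ : 0 < 4 * a - 1 := by
      by_contra h
      nlinarith
    have hg : (3 - 5 * a) + s * (8 * a - 5) ≤ 0 := by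
      rcases le_total 0 (8 * a - 5) with h | h
      · nlinarith
      · by_contra hcon
        push Not at hcon
        nlinarith [mul_pos hQ hcon, mul_nonneg (neg_nonneg.2 h) (sub_nonneg.2 hy.le),
          sq_nonneg (2 * a - 1)]
    rcases le_total 0 (4 * s - 3) with h | h
    · nlinarith
    · by_contra hcon
      push Not at hcon
      nlinarith [mul_pos hP (sub_pos.2 hcon), mul_nonneg (neg_nonneg.2 h) (sub_nonneg.2 hx.le)]

lemma mem_of_barycentric {S : Set (ℤ × ℤ)}
    (hdc : ∀ z, toR2 z ∈ convexHull ℝ (toR2 '' S) → z ∈ S) {a b c z : ℤ × ℤ}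
    (ha : a ∈ S) (hb : b ∈ S) (hc : c ∈ S) {α β γ : ℤ} (hα : 0 ≤ α) (hβ : 0 ≤ β) (hγ : 0 ≤ γ)
    (hpos : 0 < α + β + γ) (h₁ : (α + β + γ) * z.1 = α * a.1 + β * b.1 + γ * c.1)
    (h₂ : (α + β + γ) * z.2 = α * a.2 + β * b.2 + γ * c.2) : z ∈ S := by
  apply hdc
  have hN : (0 : ℝ) < α + β + γ := by exact_mod_cast hpos
  have h₁' : ((α : ℝ) + β + γ) * z.1 = α * a.1 + β * b.1 + γ * c.1 := by exact_mod_cast h₁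
  have h₂' : ((α : ℝ) + β + γ) * z.2 = α * a.2 + β * b.2 + γ * c.2 := by exact_mod_cast h₂
  have hull : ∀ s ∈ S, toR2 s ∈ convexHull ℝ (toR2 '' S) := fun s hs =>
    subset_convexHull ℝ _ ⟨s, hs, rfl⟩
  have := (convex_convexHull ℝ (toR2 '' S)).sum_mem (t := Finset.univ)
    (w := ![(α : ℝ) / (α + β + γ), β / (α + β + γ), γ / (α + β + γ)])
    (z := ![toR2 a, toR2 b, toR2 c]) ?_ ?_ ?_
  · convert this using 1
    ext
    · simp [Fin.sum_univ_three, toR2]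
      field_simp
      linarith
    · simp [Fin.sum_univ_three, toR2]
      field_simp
      linarith
  · have : (0 : ℝ) ≤ α := by exact_mod_cast hα
    have : (0 : ℝ) ≤ β := by exact_mod_cast hβ
    have : (0 : ℝ) ≤ γ := by exact_mod_cast hγ
    intro i _
    fin_cases i <;> simp <;> positivity
  · simp [Fin.sum_univ_three]
    field_simp
  · intro i _
    fin_cases i
    exacts [hull a ha, hull b hb, hull c hc]

/-- The lattice points in the rows of index `j` and `h - j` of the triangle with vertices `(0, 0)`,
`(d, 0)` and `(A, h)` number at least `d`; row `j` is
`[-(-(A * j) / h), (A * j + d * (h - j)) / h]`. -/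
lemma le_rowLength_add_rowLength {d A h j : ℤ} (hh : 1 ≤ h) :
    d ≤ ((A * j + d * (h - j)) / h + 1 - -(-(A * j) / h)) +
      ((A * (h - j) + d * (h - (h - j))) / h + 1 - -(-(A * (h - j)) / h)) := by
  have hpos : 0 < h := by omega
  have r₁ := Int.lt_ediv_add_one_mul_self (A * j + d * (h - j)) hpos
  have r₂ := Int.lt_ediv_add_one_mul_self (A * (h - j) + d * (h - (h - j))) hpos
  have l₁ := Int.lt_ediv_add_one_mul_self (-(A * j)) hpos
  have l₂ := Int.lt_ediv_add_one_mul_self (-(A * (h - j))) hpos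
  set R₁ := (A * j + d * (h - j)) / h
  set R₂ := (A * (h - j) + d * (h - (h - j))) / h
  set L₁ := -(A * j) / h
  set L₂ := -(A * (h - j)) / h
  have hR : A + d < R₁ + R₂ + 2 := by
    refine lt_of_mul_lt_mul_right (a := h) ?_ hpos.le
    linarith
  have hL : -A < L₁ + L₂ + 2 := by
    refine lt_of_mul_lt_mul_right (a := h) ?_ hpos.le
    linarith
  omega

lemma le_two_mul_ncard_of_triangle {S : Set (ℤ × ℤ)} (hfin : S.Finite)
    (hdc : ∀ z, toR2 z ∈ convexHull ℝ (toR2 '' S) → z ∈ S) {x y d A h ε : ℤ} (hε : ε * ε = 1)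
    (hd : 1 ≤ d) (hh : 1 ≤ h) (hl : (x, y) ∈ S) (hr : (x + d, y) ∈ S)
    (ht : (x + A, y + ε * h) ∈ S) :
    d * (h - 1) + 2 ≤ 2 * ({z ∈ S | 0 < ε * (z.2 - y)}.ncard : ℤ) := by
  have hpos : 0 < h := by omega
  set L : ℤ → ℤ := fun j => -(-(A * j) / h) with hL
  set R : ℤ → ℤ := fun j => (A * j + d * (h - j)) / h with hR
  set P : Finset (Σ _ : ℤ, ℤ) := (Finset.Icc 1 (h - 1)).sigma fun j => Finset.Icc (L j) (R j)
    with hP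
  have hcard : d * (h - 1) ≤ 2 * (P.card : ℤ) := by
    have h1 : ∑ j ∈ Finset.Icc 1 (h - 1), (R j + 1 - L j) ≤ (P.card : ℤ) := by
      rw [hP, Finset.card_sigma, Nat.cast_sum]
      refine Finset.sum_le_sum fun j _ => ?_
      rw [Int.card_Icc]
      exact Int.self_le_toNat _
    have h2 : ∑ j ∈ Finset.Icc 1 (h - 1), (R (h - j) + 1 - L (h - j)) =
        ∑ j ∈ Finset.Icc 1 (h - 1), (R j + 1 - L j) := by
      refine Finset.sum_nbij' (fun j => h - j) (fun j => h - j) ?_ ?_ ?_ ?_ ?_ <;>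
        simp only [Finset.mem_Icc] <;> intros <;> first | omega | trivial
    have h3 : ∑ j ∈ Finset.Icc 1 (h - 1), d ≤
        ∑ j ∈ Finset.Icc 1 (h - 1), ((R j + 1 - L j) + (R (h - j) + 1 - L (h - j))) :=
      Finset.sum_le_sum fun j _ => le_rowLength_add_rowLength hh
    rw [Finset.sum_add_distrib, h2, Finset.sum_const, Int.card_Icc, nsmul_eq_mul,
      Int.toNat_of_nonneg (by omega)] at h3
    linarith
  set φ : (Σ _ : ℤ, ℤ) → ℤ × ℤ := fun p => (x + p.2, y + ε * p.1) with hφ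
  have hφinj : Function.Injective φ := by
    rintro ⟨j, i⟩ ⟨j', i'⟩ hp
    simp only [hφ, Prod.mk.injEq, add_right_inj] at hp
    obtain ⟨rfl, hp⟩ := hp
    have : j = j' := by
      have := congrArg (ε * ·) hp
      simpa [← mul_assoc, hε] using this
    subst this
    rfl
  have htop : (x + A, y + ε * h) ∉ P.image φ := by
    intro hmem
    obtain ⟨p, hp, hpe⟩ := Finset.mem_image.1 hmem
    have : p = ⟨h, A⟩ := hφinj hpe
    subst this
    simp [hP] at hp
  have hsub : ((insert (x + A, y + ε * h) (P.image φ) : Finset (ℤ × ℤ)) : Set (ℤ × ℤ)) ⊆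
      {z ∈ S | 0 < ε * (z.2 - y)} := by
    intro z hz
    rw [Finset.mem_coe, Finset.mem_insert, Finset.mem_image] at hz
    rcases hz with rfl | ⟨⟨j, i⟩, hp, rfl⟩
    · refine ⟨ht, ?_⟩
      have : ε * (y + ε * h - y) = h := by linear_combination h * hε
      simp only [this]
      exact hpos
    · simp only [hP, Finset.mem_sigma, Finset.mem_Icc] at hp
      obtain ⟨⟨hj1, hj2⟩, hi1, hi2⟩ := hp
      have e1 : A * j ≤ h * i := by
        have := Int.ediv_mul_le (-(A * j)) hpos.ne'
        simp only [hL] at hi1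
        nlinarith
      have e2 : h * i ≤ A * j + d * (h - j) := by
        have := Int.ediv_mul_le (A * j + d * (h - j)) hpos.ne'
        simp only [hR] at hi2
        nlinarith
      refine ⟨mem_of_barycentric hdc hl hr ht (α := d * (h - j) - (h * i - A * j))
        (β := h * i - A * j) (γ := j * d) (by linarith) (by linarith)
        (mul_nonneg (by omega) (by omega)) ?_ ?_ ?_, ?_⟩
      · have : 0 < d * h := mul_pos (by omega) hpos
        linarith
      · simp only [hφ]; ring
      · simp only [hφ]; ring
      · have : ε * (y + ε * j - y) = j := by linear_combination j * hε
        simp only [hφ, this]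
        omega
  have := Set.ncard_le_ncard hsub (hfin.subset (Set.sep_subset _ _))
  rw [Set.ncard_coe_finset, Finset.card_insert_of_notMem htop,
    Finset.card_image_of_injective _ hφinj] at this
  omega

lemma le_ncard_row {S : Set (ℤ × ℤ)} (hfin : S.Finite)
    (hdc : ∀ z, toR2 z ∈ convexHull ℝ (toR2 '' S) → z ∈ S) {x y d : ℤ}
    (hd : 1 ≤ d) (hl : (x, y) ∈ S) (hr : (x + d, y) ∈ S) :
    d + 1 ≤ ({z ∈ S | z.2 = y}.ncard : ℤ) := by
  have hsub : (((Finset.Icc 0 d).image fun i => (x + i, y) : Finset (ℤ × ℤ)) : Set (ℤ × ℤ)) ⊆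
      {z ∈ S | z.2 = y} := by
    intro z hz
    obtain ⟨i, hi, rfl⟩ := Finset.mem_image.1 (Finset.mem_coe.1 hz)
    rw [Finset.mem_Icc] at hi
    exact ⟨mem_of_barycentric hdc hl hr hr (α := d - i) (β := i) (γ := 0) (by omega) hi.1 le_rfl
      (by omega) (by simp; ring) (by simp only; ring), rfl⟩
  have := Set.ncard_le_ncard hsub (hfin.subset (Set.sep_subset _ _))
  rw [Set.ncard_coe_finset, Finset.card_image_of_injective _ (fun i j h => by simpa using h),
    Int.card_Icc] at this
  omega

/-- A digital convex set with a horizontal lattice segment of length `d` and vertical width at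
least `w` has at least as many points as the triangles over that segment. -/
lemma le_two_mul_ncard {S : Set (ℤ × ℤ)} (hfin : S.Finite)
    (hdc : ∀ z, toR2 z ∈ convexHull ℝ (toR2 '' S) → z ∈ S) {x y d w : ℤ} (hw : 1 ≤ w)
    (hd : 1 ≤ d) (hl : (x, y) ∈ S) (hr : (x + d, y) ∈ S)
    (hwd : ∃ a ∈ S, ∃ b ∈ S, w ≤ b.2 - a.2) :
    d * w + 6 ≤ 2 * (S.ncard : ℤ) ∨ d * w + d + 4 ≤ 2 * (S.ncard : ℤ) := by
  obtain ⟨a', ha', b', hb', hab⟩ := hwd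
  obtain ⟨b, hb, hbmax⟩ := hfin.exists_maximalFor Prod.snd S ⟨_, hl⟩
  obtain ⟨a, ha, hamin⟩ := hfin.exists_minimalFor Prod.snd S ⟨_, hl⟩
  have le_b : ∀ s ∈ S, s.2 ≤ b.2 := fun s hs => by
    rcases le_total s.2 b.2 with h | h
    exacts [h, hbmax hs h]
  have a_le : ∀ s ∈ S, a.2 ≤ s.2 := fun s hs => by
    rcases le_total a.2 s.2 with h | h
    exacts [h, hamin hs h]
  have hyb := le_b _ hl
  have hay := a_le _ hl
  have hb'b := le_b _ hb'
  have haa' := a_le _ ha'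
  have hrow := le_ncard_row hfin hdc hd hl hr
  have hup : 0 < b.2 - y → d * (b.2 - y - 1) + 2 ≤ 2 * ({z ∈ S | y < z.2}.ncard : ℤ) := by
    intro h
    have := le_two_mul_ncard_of_triangle hfin hdc (ε := 1) (A := b.1 - x) (h := b.2 - y)
      (by norm_num) hd h hl hr (by simpa using hb)
    simpa using this
  have hdown : 0 < y - a.2 → d * (y - a.2 - 1) + 2 ≤ 2 * ({z ∈ S | z.2 < y}.ncard : ℤ) := by
    intro h
    have := le_two_mul_ncard_of_triangle hfin hdc (ε := -1) (A := a.1 - x) (h := y - a.2)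
      (by norm_num) hd h hl hr (by simpa using ha)
    simpa using this
  have htot : S.ncard = {z ∈ S | y < z.2}.ncard + {z ∈ S | z.2 = y}.ncard +
      {z ∈ S | z.2 < y}.ncard := by
    have f : ∀ p : ℤ × ℤ → Prop, {z ∈ S | p z}.Finite := fun p =>
      hfin.subset (Set.sep_subset _ _)
    rw [← Set.ncard_union_eq _ (f _) (f _), ← Set.ncard_union_eq _ ((f _).union (f _)) (f _)]
    · congr 1
      ext z
      simp only [Set.mem_union, Set.mem_ofPred_eq]
      have := lt_trichotomy z.2 y
      tauto
    · rw [Set.disjoint_left]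
      rintro z (h | h) h' <;> have := h.2 <;> have := h'.2 <;> omega
    · rw [Set.disjoint_left]
      intro z h h'
      have := h.2
      have := h'.2
      omega
  have hmul : d * w ≤ d * (b.2 - a.2) := mul_le_mul_of_nonneg_left (by omega) (by omega)
  rcases hyb.eq_or_lt with h | h
  · right
    have := hdown (by simp only at h; omega)
    simp only at h
    rw [← h] at hmul
    push_cast [htot]
    nlinarith
  · rcases hay.eq_or_lt with h' | h'
    · right
      have := hup (by simp only at h; omega)
      simp only at h'
      rw [h'] at hmul
      push_cast [htot]
      nlinarith
    · left
      have := hup (by simp only at h; omega)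
      have := hdown (by simp only at h'; omega)
      push_cast [htot]
      nlinarith

/-- A point of a convex hull maximizing a linear functional `f` lies in the hull of the points
maximizing `f`, so on either side of it there is such a point. -/
lemma exists_mem_face {E : Type*} [AddCommGroup E] [Module ℝ E] {T : Set E} {z : E}
    (hz : z ∈ convexHull ℝ T) (f g : E →ₗ[ℝ] ℝ) (hf : ∀ s ∈ T, f s ≤ f z) :
    ∃ s ∈ T, f s = f z ∧ g s ≤ g z := by
  by_contra! h
  have hconv : Convex ℝ {y | f y < f z ∨ (f y = f z ∧ g z < g y)} := by
    intro p hp q hq a b ha hb hab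
    obtain rfl : b = 1 - a := by linarith
    simp only [Set.mem_ofPred_eq, map_add, map_smul, smul_eq_mul] at hp hq ⊢
    rcases ha.eq_or_lt with rfl | ha
    · simpa using hq
    rcases hb.eq_or_lt with hb | hb
    · obtain rfl : a = 1 := by linarith
      simpa using hp
    rcases hp with hp | ⟨hp, hp'⟩ <;> rcases hq with hq | ⟨hq, hq'⟩
    · left; nlinarith
    · left; nlinarith
    · left; nlinarith
    · right
      exact ⟨by rw [hp, hq]; ring, by nlinarith⟩
  have : z ∈ {y | f y < f z ∨ (f y = f z ∧ g z < g y)} := by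
    refine convexHull_min (fun s hs => ?_) hconv hz
    rcases (hf s hs).lt_or_eq with hlt | heq
    exacts [Or.inl hlt, Or.inr ⟨heq, h s hs heq⟩]
  simp at this

lemma mem_of_mem_line {K : Set (ℝ × ℝ)} (hK : Convex ℝ K) {t : ℝ} {p q z : ℝ × ℝ} (hp : p ∈ K)
    (hq : q ∈ K) (hpz : p.2 ≤ z.2) (hzq : z.2 ≤ q.2) (hp' : p.1 + t * p.2 = z.1 + t * z.2)
    (hq' : q.1 + t * q.2 = z.1 + t * z.2) : z ∈ K := by
  rcases hpz.eq_or_lt with h | h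
  · rw [h] at hp'
    obtain rfl : p = z := Prod.ext (by linarith) h
    exact hp
  · have hpos : 0 < q.2 - p.2 := by linarith
    have := hK hp hq (a := (q.2 - z.2) / (q.2 - p.2)) (b := (z.2 - p.2) / (q.2 - p.2))
      (div_nonneg (by linarith) hpos.le) (div_nonneg (by linarith) hpos.le)
      (by field_simp; ring)
    have h₁ : p.1 = z.1 + t * z.2 - t * p.2 := by linarith
    have h₂ : q.1 = z.1 + t * z.2 - t * q.2 := by linarith
    convert this using 1
    ext
    · simp only [Prod.fst_add, Prod.smul_fst, smul_eq_mul, h₁, h₂]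
      field_simp
      ring
    · simp only [Prod.snd_add, Prod.smul_snd, smul_eq_mul]
      field_simp
      ring

/-- If a longest horizontal chord lies between two parallel supporting lines, it can be slid along
them until one of its endpoints is a lattice point of the set. -/
lemma exists_horizontal_segment {S : Set (ℤ × ℤ)}
    (hdc : ∀ z, toR2 z ∈ convexHull ℝ (toR2 '' S) → z ∈ S) {ℓ t : ℝ} {d : ℤ} (hd : 1 ≤ d)
    (hdℓ : (d : ℝ) ≤ ℓ) (hℓ : (ℓ, 0) ∈ diffBody S)
    (hstrip : ∀ z ∈ diffBody S, |z.1 + t * z.2| ≤ ℓ) :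
    ∃ x y : ℤ, (x, y) ∈ S ∧ (x + d, y) ∈ S := by
  set K := convexHull ℝ (toR2 '' S) with hKdef
  have hK : Convex ℝ K := convex_convexHull ℝ _
  have hSK : ∀ s ∈ S, toR2 s ∈ K := fun s hs => subset_convexHull ℝ _ ⟨s, hs, rfl⟩
  obtain ⟨a, ha, b, hb, hab⟩ := Set.mem_sub.1 hℓ
  have hab1 : a.1 - b.1 = ℓ := congrArg Prod.fst hab
  have hab2 : a.2 = b.2 := sub_eq_zero.1 (congrArg Prod.snd hab)
  have hmax : ∀ s ∈ K, s.1 + t * s.2 ≤ a.1 + t * a.2 := by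
    intro s hs
    have := (abs_le.1 (hstrip _ (Set.sub_mem_sub hs hb))).2
    simp only [Prod.fst_sub, Prod.snd_sub] at this
    rw [hab2]
    linarith
  have hmin : ∀ s ∈ K, b.1 + t * b.2 ≤ s.1 + t * s.2 := by
    intro s hs
    have := (abs_le.1 (hstrip _ (Set.sub_mem_sub ha hs))).2
    simp only [Prod.fst_sub, Prod.snd_sub] at this
    rw [hab2] at this
    linarith
  have hTK : ∀ s ∈ toR2 '' S, s ∈ K := fun s hs => subset_convexHull ℝ _ hs
  set f : ℝ × ℝ →ₗ[ℝ] ℝ := LinearMap.fst ℝ ℝ ℝ + t • LinearMap.snd ℝ ℝ ℝ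
  have hf : ∀ z, f z = z.1 + t * z.2 := fun z => by simp [f]
  have hsnd : ∀ z : ℝ × ℝ, LinearMap.snd ℝ ℝ ℝ z = z.2 := fun z => rfl
  obtain ⟨_, ⟨a₁, ha₁, rfl⟩, fa₁, ga₁⟩ := exists_mem_face ha f (LinearMap.snd ℝ ℝ ℝ)
    (fun s hs => by simpa only [hf] using hmax s (hTK s hs))
  obtain ⟨_, ⟨a₂, ha₂, rfl⟩, fa₂, ga₂⟩ := exists_mem_face ha f (-LinearMap.snd ℝ ℝ ℝ)
    (fun s hs => by simpa only [hf] using hmax s (hTK s hs))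
  obtain ⟨_, ⟨b₁, hb₁, rfl⟩, fb₁, gb₁⟩ := exists_mem_face hb (-f) (LinearMap.snd ℝ ℝ ℝ)
    (fun s hs => by simpa only [hf, LinearMap.neg_apply, neg_le_neg_iff] using hmin s (hTK s hs))
  obtain ⟨_, ⟨b₂, hb₂, rfl⟩, fb₂, gb₂⟩ := exists_mem_face hb (-f) (-LinearMap.snd ℝ ℝ ℝ)
    (fun s hs => by simpa only [hf, LinearMap.neg_apply, neg_le_neg_iff] using hmin s (hTK s hs))
  simp only [LinearMap.neg_apply, neg_inj, neg_le_neg_iff, hf, hsnd] at *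
  have hd' : (1 : ℝ) ≤ d := by exact_mod_cast hd
  have hℓpos : 0 < ℓ := by linarith
  have hw1 : 0 ≤ 1 - (d : ℝ) / ℓ := by
    rw [sub_nonneg, div_le_one hℓpos]
    exact hdℓ
  rcases le_total (toR2 a₂).2 (toR2 b₂).2 with h | h
  · have hq : ((toR2 a₂).1 - ℓ, (toR2 a₂).2) ∈ K :=
      mem_of_mem_line hK (hSK _ hb₁) (hSK _ hb₂) (t := t) (by simp only; linarith) h
        (by simp only; rw [hab2] at fa₂; linarith) (by simp only; rw [hab2] at fa₂; linarith)
    refine ⟨a₂.1 - d, a₂.2, hdc _ ?_, by simpa using ha₂⟩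
    have := hK (hSK _ ha₂) hq (a := 1 - d / ℓ) (b := d / ℓ) hw1 (by positivity) (by ring)
    convert this using 1
    ext
    · simp [toR2]
      field_simp
      ring
    · simp [toR2]
      field_simp
      ring
  · have hq : ((toR2 b₂).1 + ℓ, (toR2 b₂).2) ∈ K :=
      mem_of_mem_line hK (hSK _ ha₁) (hSK _ ha₂) (t := t) (by simp only; linarith) h
        (by simp only; rw [hab2] at fa₁; linarith) (by simp only; rw [hab2] at fa₂; linarith)
    refine ⟨b₂.1, b₂.2, by simpa using hb₂, hdc _ ?_⟩
    have := hK (hSK _ hb₂) hq (a := 1 - d / ℓ) (b := d / ℓ) hw1 (by positivity) (by ring)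
    convert this using 1
    ext
    · simp [toR2]
      field_simp
      ring
    · simp [toR2]
      field_simp
      ring

/-- `S` is a finite digital convex set of lattice width at least `w`, and `ℓ` bounds the lattice
lengths of the chords of its convex hull in lattice directions. -/
structure HasWidthAndChords (S : Set (ℤ × ℤ)) (w : ℤ) (ℓ : ℝ) : Prop where
  finite : S.Finite
  mem_of_toR2_mem : ∀ z, toR2 z ∈ convexHull ℝ (toR2 '' S) → z ∈ S
  width : ∀ u : ℤ × ℤ, u ≠ 0 →
    ∃ a ∈ S, ∃ b ∈ S, w ≤ u.1 * (b.1 - a.1) + u.2 * (b.2 - a.2)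
  chord : ∀ v : ℤ × ℤ, v ≠ 0 → ∀ c : ℝ, c • toR2 v ∈ diffBody S → c ≤ ℓ

namespace HasWidthAndChords

variable {S : Set (ℤ × ℤ)} {w : ℤ} {ℓ : ℝ}

lemma exists_strip (H : HasWidthAndChords S w ℓ) (hw : 1 ≤ w) (hℓ : 0 < ℓ) {v : ℤ × ℤ}
    (hv : v ≠ 0) :
    ∃ p q : ℝ, p * v.1 + q * v.2 = 1 ∧ ∀ z ∈ diffBody S, |p * z.1 + q * z.2| ≤ ℓ := by
  obtain ⟨p, q, h₁, h₂⟩ := exists_supporting_strip (x := ℓ • toR2 v) (convex_diffBody S)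
    (fun z hz => neg_mem_diffBody hz) (zero_mem_interior_diffBody hw H.width) (by
      intro c hc hmem
      rw [smul_smul] at hmem
      nlinarith [H.chord v hv _ hmem])
  refine ⟨p * ℓ, q * ℓ, ?_, fun z hz => ?_⟩
  · simp only [toR2, Prod.smul_fst, Prod.smul_snd, smul_eq_mul] at h₁
    linarith
  · rw [show p * ℓ * z.1 + q * ℓ * z.2 = ℓ * (p * z.1 + q * z.2) by ring, abs_mul,
      abs_of_pos hℓ]
    exact mul_le_of_le_one_right hℓ.le (h₂ z hz)

lemma width_le (H : HasWidthAndChords S w ℓ) {u : ℤ × ℤ} (hu : u ≠ 0) {c : ℝ}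
    (h : ∀ z ∈ diffBody S, u.1 * z.1 + u.2 * z.2 ≤ c) : (w : ℝ) ≤ c := by
  obtain ⟨a, ha, b, hb, hab⟩ := H.width u hu
  have h' := h _ (sub_mem_diffBody hb ha)
  have hab' : (w : ℝ) ≤ u.1 * (b.1 - a.1) + u.2 * (b.2 - a.2) := by exact_mod_cast hab
  simp only [toR2, Prod.fst_sub, Prod.snd_sub, Int.cast_sub] at h'
  linarith

lemma width_le_four_thirds (H : HasWidthAndChords S w ℓ) (hw : 1 ≤ w) (hℓ : 0 < ℓ)
    (hmem : (ℓ, 0) ∈ diffBody S) {t : ℝ} (ht : 0 ≤ t) (ht1 : t < 1)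
    (hstrip : ∀ z ∈ diffBody S, |z.1 + t * z.2| ≤ ℓ) : (w : ℝ) ≤ 4 / 3 * ℓ := by
  obtain ⟨s, q, hsq, hs⟩ := H.exists_strip hw hℓ (v := (0, 1)) (by simp)
  obtain ⟨a, r, har, ha⟩ := H.exists_strip hw hℓ (v := (1, -1)) (by simp)
  simp only [Int.cast_zero, Int.cast_one, Int.cast_neg, mul_zero, zero_add, mul_one] at hsq har
  subst hsq
  obtain rfl : r = -(1 - a) := by linarith
  simp only [one_mul, neg_mul, ← sub_eq_add_neg] at hs ha
  have le_one : ∀ p : ℝ, |p * ℓ| ≤ ℓ → p ≤ 1 := fun p hp => by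
    nlinarith [(abs_le.1 hp).2]
  have hs1 : s ≤ 1 := le_one s (by simpa using hs _ hmem)
  have ha1 : a ≤ 1 := le_one a (by simpa using ha _ hmem)
  have case₁ : (∀ z ∈ diffBody S, z.1 ≤ 4 / 3 * ℓ) → (w : ℝ) ≤ 4 / 3 * ℓ := fun h =>
    H.width_le (u := (1, 0)) (by simp) (by simpa using h)
  have case₂ : (∀ z ∈ diffBody S, z.2 ≤ 4 / 3 * ℓ) → (w : ℝ) ≤ 4 / 3 * ℓ := fun h =>
    H.width_le (u := (0, 1)) (by simp) (by simpa using h)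
  have case₃ : (∀ z ∈ diffBody S, z.1 + z.2 ≤ 4 / 3 * ℓ) → (w : ℝ) ≤ 4 / 3 * ℓ := fun h =>
    H.width_le (u := (1, 1)) (by simp) (by simpa using h)
  rcases le_total s 0 with hs0 | hs0
  · rcases two_strips_bound ht hs0 hstrip hs with h | h
    exacts [case₁ h, case₂ h]
  rcases le_total a 0 with ha0 | ha0
  · rcases two_strips_bound (D := {z | (z.1 + z.2, -z.2) ∈ diffBody S}) (sub_nonneg.2 ht1.le) ha0
      (fun z hz => by convert hstrip _ hz using 2; ring)
      (fun z hz => by convert ha _ hz using 2; ring) with h | h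
    · exact case₃ fun z hz => h (z.1 + z.2, -z.2) (by simpa using hz)
    · refine case₂ fun z hz => ?_
      have hmem' : (-(z.1 + z.2) + z.2, -z.2) ∈ diffBody S := by
        convert neg_mem_diffBody hz using 1
        ext <;> simp
      exact h (-(z.1 + z.2), z.2) hmem'
  · rcases three_strips_bound hℓ.le ht ht1 hs0 hs1 ha0 ha1 hstrip hs ha with h | h | h
    exacts [case₁ h, case₂ h, case₃ h]

/-- The linear map of the real plane with matrix `!![α, β; γ, δ]`. -/
def planeMap (α β γ δ : ℝ) : ℝ × ℝ →ₗ[ℝ] ℝ × ℝ :=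
  (α • LinearMap.fst ℝ ℝ ℝ + β • LinearMap.snd ℝ ℝ ℝ).prod
    (γ • LinearMap.fst ℝ ℝ ℝ + δ • LinearMap.snd ℝ ℝ ℝ)

lemma planeMap_apply (α β γ δ : ℝ) (z : ℝ × ℝ) :
    planeMap α β γ δ z = (α * z.1 + β * z.2, γ * z.1 + δ * z.2) := by
  simp [planeMap]

/-- The linear map of the integer plane with matrix `!![α, β; γ, δ]`. -/
def latticeMap (α β γ δ : ℤ) (z : ℤ × ℤ) : ℤ × ℤ := (α * z.1 + β * z.2, γ * z.1 + δ * z.2)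

lemma toR2_latticeMap (α β γ δ : ℤ) (z : ℤ × ℤ) :
    toR2 (latticeMap α β γ δ z) = planeMap α β γ δ (toR2 z) := by
  simp [toR2, latticeMap, planeMap_apply]

lemma hull_latticeMap (α β γ δ : ℤ) (S : Set (ℤ × ℤ)) :
    convexHull ℝ (toR2 '' (latticeMap α β γ δ '' S)) =
      planeMap α β γ δ '' convexHull ℝ (toR2 '' S) := by
  rw [LinearMap.image_convexHull, Set.image_image, Set.image_image]
  simp only [toR2_latticeMap]

lemma diffBody_latticeMap (α β γ δ : ℤ) (S : Set (ℤ × ℤ)) :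
    diffBody (latticeMap α β γ δ '' S) = planeMap α β γ δ '' diffBody S := by
  rw [diffBody, diffBody, hull_latticeMap, Set.image_sub]

lemma latticeMap_leftInverse {α β γ δ : ℤ} (hdet : α * δ - β * γ = 1) (z : ℤ × ℤ) :
    latticeMap δ (-β) (-γ) α (latticeMap α β γ δ z) = z := by
  ext
  · simp only [latticeMap]; linear_combination z.1 * hdet
  · simp only [latticeMap]; linear_combination z.2 * hdet

lemma latticeMap_rightInverse {α β γ δ : ℤ} (hdet : α * δ - β * γ = 1) (z : ℤ × ℤ) :
    latticeMap α β γ δ (latticeMap δ (-β) (-γ) α z) = z := by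
  ext
  · simp only [latticeMap]; linear_combination z.1 * hdet
  · simp only [latticeMap]; linear_combination z.2 * hdet

lemma latticeMap_injective {α β γ δ : ℤ} (hdet : α * δ - β * γ = 1) :
    Function.Injective (latticeMap α β γ δ) :=
  Function.LeftInverse.injective (latticeMap_leftInverse hdet)

lemma planeMap_injective {α β γ δ : ℝ} (hdet : α * δ - β * γ = 1) :
    Function.Injective (planeMap α β γ δ) := by
  intro z z' h
  simp only [planeMap_apply, Prod.mk.injEq] at h
  ext
  · linear_combination δ * h.1 - β * h.2 + (z'.1 - z.1) * hdet
  · linear_combination α * h.2 - γ * h.1 + (z'.2 - z.2) * hdet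

lemma image (H : HasWidthAndChords S w ℓ) {α β γ δ : ℤ} (hdet : α * δ - β * γ = 1) :
    HasWidthAndChords (latticeMap α β γ δ '' S) w ℓ := by
  have hinj : Function.Injective (planeMap α β γ δ) :=
    planeMap_injective (by exact_mod_cast hdet)
  refine ⟨H.finite.image _, fun z hz => ?_, fun u hu => ?_, fun v hv c hc => ?_⟩
  · rw [hull_latticeMap, ← latticeMap_rightInverse hdet z, toR2_latticeMap,
      hinj.mem_set_image] at hz
    exact ⟨_, H.mem_of_toR2_mem _ hz, latticeMap_rightInverse hdet z⟩
  · obtain ⟨a, ha, b, hb, h⟩ := H.width (u.1 * α + u.2 * γ, u.1 * β + u.2 * δ) (by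
      intro h0
      simp only [Prod.mk_eq_zero] at h0
      refine hu (Prod.ext ?_ ?_)
      · simp only [Prod.fst_zero]
        linear_combination δ * h0.1 - γ * h0.2 - u.1 * hdet
      · simp only [Prod.snd_zero]
        linear_combination α * h0.2 - β * h0.1 - u.2 * hdet)
    refine ⟨_, ⟨a, ha, rfl⟩, _, ⟨b, hb, rfl⟩, h.trans_eq ?_⟩
    simp only [latticeMap]
    ring
  · rw [diffBody_latticeMap, ← latticeMap_rightInverse hdet v, toR2_latticeMap, ← map_smul,
      hinj.mem_set_image] at hc
    refine H.chord _ (fun h0 => hv ?_) c hc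
    rw [← latticeMap_rightInverse hdet v, h0]
    simp [latticeMap]

lemma bound_of_horizontal (H : HasWidthAndChords S w ℓ) (hw : 1 ≤ w) (hℓ : 1 ≤ ℓ)
    (hmem : (ℓ, 0) ∈ diffBody S) {t : ℝ} (ht : 0 ≤ t) (ht1 : t < 1)
    (hstrip : ∀ z ∈ diffBody S, |z.1 + t * z.2| ≤ ℓ) :
    3 * w ^ 2 - 4 * w + 24 ≤ 8 * (S.ncard : ℤ) := by
  have hwidth := H.width_le_four_thirds hw (by linarith) hmem ht ht1 hstrip
  have hd : 1 ≤ ⌊ℓ⌋ := Int.le_floor.2 (by simpa using hℓ)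
  have hwd : 3 * w < 4 * (⌊ℓ⌋ + 1) := by
    have : (3 : ℝ) * w < 4 * (⌊ℓ⌋ + 1) := by linarith [Int.lt_floor_add_one ℓ]
    exact_mod_cast this
  obtain ⟨x, y, hl, hr⟩ := exists_horizontal_segment H.mem_of_toR2_mem hd (Int.floor_le ℓ) hmem
    hstrip
  generalize ⌊ℓ⌋ = d at *
  rcases le_two_mul_ncard H.finite H.mem_of_toR2_mem hw hd hl hr
    (by simpa using H.width (0, 1) (by simp)) with h | h
  · nlinarith
  · rcases hd.eq_or_lt with rfl | hd
    · have : w ≤ 2 := by omega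
      interval_cases w <;> omega
    · nlinarith

lemma bound (H : HasWidthAndChords S w ℓ) (hw : 1 ≤ w) (hℓ : 1 ≤ ℓ) {v : ℤ × ℤ}
    (hv : v ≠ 0) (hmem : ℓ • toR2 v ∈ diffBody S) :
    3 * w ^ 2 - 4 * w + 24 ≤ 8 * (S.ncard : ℤ) := by
  have hcop : IsCoprime v.1 v.2 := by
    rw [Int.isCoprime_iff_gcd_eq_one]
    have hg : v.1.gcd v.2 ≠ 0 := fun h => hv (Prod.ext (Int.gcd_eq_zero_iff.1 h).1
      (Int.gcd_eq_zero_iff.1 h).2)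
    obtain ⟨p, hp⟩ := Int.gcd_dvd_left v.1 v.2
    obtain ⟨q, hq⟩ := Int.gcd_dvd_right v.1 v.2
    generalize v.1.gcd v.2 = g at *
    have := H.chord (p, q) (fun h => hv (by
      simp only [Prod.mk_eq_zero] at h
      exact Prod.ext (by simp [hp, h.1]) (by simp [hq, h.2]))) (ℓ * g) (by
      convert hmem using 1
      simp [toR2, hp, hq, mul_assoc])
    have hg1 : (g : ℝ) ≤ 1 := by nlinarith
    have : g ≤ 1 := by exact_mod_cast hg1
    omega
  obtain ⟨α, β, hαβ⟩ := hcop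
  have hdet : α * v.1 - β * -v.2 = 1 := by linarith
  have H₁ := H.image hdet
  have hmem₁ : (ℓ, 0) ∈ diffBody (latticeMap α β (-v.2) v.1 '' S) := by
    rw [diffBody_latticeMap]
    refine ⟨_, hmem, ?_⟩
    have hαβ' : (α : ℝ) * v.1 + β * v.2 = 1 := by exact_mod_cast hαβ
    rw [map_smul, planeMap_apply]
    ext
    · simp [toR2, hαβ']
    · simp [toR2]
      right
      ring
  have hcard₁ := Set.ncard_image_of_injective S (latticeMap_injective hdet)
  generalize latticeMap α β (-v.2) v.1 '' S = S₁ at *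
  obtain ⟨p, t, hp, hstrip⟩ := H₁.exists_strip hw (by linarith) (v := (1, 0)) (by simp)
  obtain rfl : p = 1 := by simpa using hp
  have hdet₂ : (1 : ℤ) * 1 - ⌊t⌋ * 0 = 1 := by ring
  have := (H₁.image hdet₂).bound_of_horizontal hw hℓ (t := Int.fract t) (by
      rw [diffBody_latticeMap]
      exact ⟨_, hmem₁, by simp [planeMap_apply]⟩) (Int.fract_nonneg t) (Int.fract_lt_one t) (by
      rw [diffBody_latticeMap]
      rintro _ ⟨z, hz, rfl⟩
      convert hstrip z hz using 2
      simp only [planeMap_apply, Int.fract]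
      push_cast
      ring)
  rwa [Set.ncard_image_of_injective _ (latticeMap_injective hdet₂), hcard₁] at this

end HasWidthAndChords

/-- Among the chords of the convex hull in lattice directions there is one of maximal lattice
length. -/
lemma exists_longest_chord {S : Set (ℤ × ℤ)} (hfin : S.Finite) {δ : ℤ × ℤ} (hδ : δ ≠ 0)
    (hmem : toR2 δ ∈ diffBody S) :
    ∃ ℓ : ℝ, 1 ≤ ℓ ∧ (∃ v : ℤ × ℤ, v ≠ 0 ∧ ℓ • toR2 v ∈ diffBody S) ∧
      ∀ v : ℤ × ℤ, v ≠ 0 → ∀ c : ℝ, c • toR2 v ∈ diffBody S → c ≤ ℓ := by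
  have hcomp := isCompact_diffBody hfin
  obtain ⟨R, hR⟩ := hcomp.isBounded.exists_norm_le
  have hzero : (0 : ℝ × ℝ) ∈ diffBody S := by
    have := convex_diffBody S hmem (neg_mem_diffBody hmem) (a := 1 / 2) (b := 1 / 2)
      (by norm_num) (by norm_num) (by norm_num)
    simpa using this
  have hcoord : ∀ z ∈ diffBody S, |z.1| ≤ R ∧ |z.2| ≤ R := fun z hz =>
    ⟨(norm_fst_le z).trans (hR z hz), (norm_snd_le z).trans (hR z hz)⟩
  set V : Set (ℤ × ℤ) := {v | v ≠ 0 ∧ toR2 v ∈ diffBody S} with hV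
  have hVfin : V.Finite := by
    refine (Set.finite_Icc ((-⌈R⌉, -⌈R⌉) : ℤ × ℤ) (⌈R⌉, ⌈R⌉)).subset ?_
    rintro v ⟨-, hv⟩
    obtain ⟨h₁, h₂⟩ := hcoord _ hv
    have e : ∀ n : ℤ, |(n : ℝ)| ≤ R → -⌈R⌉ ≤ n ∧ n ≤ ⌈R⌉ := fun n hn => by
      have : |(n : ℝ)| ≤ ⌈R⌉ := hn.trans (Int.le_ceil R)
      exact abs_le.1 (by exact_mod_cast this)
    exact ⟨⟨(e _ h₁).1, (e _ h₂).1⟩, ⟨(e _ h₁).2, (e _ h₂).2⟩⟩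
  set Λ : Set ℝ := ⋃ v ∈ V, {c : ℝ | c • toR2 v ∈ diffBody S} with hΛ
  have hΛcomp : IsCompact Λ := by
    refine hVfin.isCompact_biUnion fun v hv => ?_
    refine Metric.isCompact_of_isClosed_isBounded
      (hcomp.isClosed.preimage (by fun_prop : Continuous fun c : ℝ => c • toR2 v)) ?_
    refine (Metric.isBounded_Icc (-R) R).subset fun c hc => abs_le.1 ?_
    have hc' := hcoord _ hc
    simp only [Prod.smul_fst, Prod.smul_snd, smul_eq_mul, toR2, abs_mul] at hc'
    have e : ∀ n : ℤ, n ≠ 0 → |c| * |(n : ℝ)| ≤ R → |c| ≤ R := fun n hn h => by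
      have : (1 : ℝ) ≤ |(n : ℝ)| := by exact_mod_cast Int.one_le_abs hn
      nlinarith [abs_nonneg c]
    by_cases h1 : v.1 = 0
    · exact e v.2 (fun h2 => hv.1 (Prod.ext h1 h2)) hc'.2
    · exact e v.1 h1 hc'.1
  have h1Λ : (1 : ℝ) ∈ Λ := Set.mem_biUnion (x := δ) ⟨hδ, hmem⟩ (by simpa using hmem)
  obtain ⟨ℓ, hℓ, hmax⟩ := hΛcomp.exists_isGreatest ⟨1, h1Λ⟩
  obtain ⟨v, hv, hvℓ⟩ := Set.mem_iUnion₂.1 hℓ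
  refine ⟨ℓ, hmax h1Λ, ⟨v, hv.1, hvℓ⟩, fun u hu c hc => ?_⟩
  rcases le_total c 1 with hc1 | hc1
  · exact hc1.trans (hmax h1Λ)
  · refine hmax (Set.mem_biUnion (x := u) ⟨hu, ?_⟩ hc)
    have := (convex_diffBody S).smul_mem_of_zero_mem hzero hc
      (t := c⁻¹) ⟨by positivity, inv_le_one_of_one_le₀ hc1⟩
    rwa [smul_smul, inv_mul_cancel₀ (by linarith), one_smul] at this

theorem discrete_blaschke_lebesgue
    (S : Set (ℤ × ℤ)) (hfin : S.Finite) (hne : S.Nonempty)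
    (hdc : DigitalConvex S) (hw : 1 ≤ latticeWidth S) :
    ((S.ncard : ℚ)) ≥
      3 / 8 * (latticeWidth S : ℚ) ^ 2 - 1 / 2 * (latticeWidth S : ℚ) + 3 := by
  have hwidth : ∀ u : ℤ × ℤ, u ≠ 0 → ∃ a ∈ S, ∃ b ∈ S,
      latticeWidth S ≤ u.1 * (b.1 - a.1) + u.2 * (b.2 - a.2) := fun u hu =>
    exists_latticeWidth_le hfin hne hu
  obtain ⟨a, ha, b, hb, hab⟩ := hwidth (1, 0) (by simp)
  have hne' : b - a ≠ 0 := by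
    intro h
    obtain rfl := sub_eq_zero.1 h
    simp at hab
    omega
  obtain ⟨ℓ, hℓ, ⟨v, hv, hvℓ⟩, hmax⟩ := exists_longest_chord hfin hne' (sub_mem_diffBody hb ha)
  have H : HasWidthAndChords S (latticeWidth S) ℓ :=
    ⟨hfin, fun z hz => hdc.subset hz, hwidth, hmax⟩
  have := H.bound hw hℓ hv hvℓ
  have h' : 3 * (latticeWidth S : ℚ) ^ 2 - 4 * latticeWidth S + 24 ≤ 8 * (S.ncard : ℚ) := by
    exact_mod_cast this
  linarith
end

section
/- For any finite nonempty digital convex set S ⊆ ℤ² of n points with n ≥ 25, one has w(S) + 1 ≤ n^{3/4}, where w(S) is the lattice width of S. -/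
/-- Closure under lattice points of triangles spanned by the set, phrased with integer weights. -/
def TriangleClosed (S : Finset (ℤ × ℤ)) : Prop :=
  ∀ p ∈ S, ∀ q ∈ S, ∀ r ∈ S, ∀ α β γ : ℤ, 0 ≤ α → 0 ≤ β → 0 ≤ γ → 0 < α + β + γ →
    ∀ z : ℤ × ℤ, (α + β + γ) * z.1 = α * p.1 + β * q.1 + γ * r.1 →
      (α + β + γ) * z.2 = α * p.2 + β * q.2 + γ * r.2 → z ∈ S

theorem DigitalConvex.triangleClosed {S : Finset (ℤ × ℤ)}
    (hS : DigitalConvex (S : Set (ℤ × ℤ))) : TriangleClosed S := by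
  intro p hp q hq r hr α β γ hα hβ hγ hpos z h1 h2
  have key : toR2 z ∈ convexHull ℝ (toR2 '' (S : Set (ℤ × ℤ))) := by
    have hc := convex_convexHull ℝ (toR2 '' (S : Set (ℤ × ℤ)))
    have hmem : ∀ x ∈ S, toR2 x ∈ convexHull ℝ (toR2 '' (S : Set (ℤ × ℤ))) := fun x hx =>
      subset_convexHull ℝ _ ⟨x, hx, rfl⟩
    have hN : (0 : ℝ) < α + β + γ := by exact_mod_cast hpos
    have hα' : (0 : ℝ) ≤ α := by exact_mod_cast hα
    have hβ' : (0 : ℝ) ≤ β := by exact_mod_cast hβ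
    have hγ' : (0 : ℝ) ≤ γ := by exact_mod_cast hγ
    have h1' : ((α : ℝ) + β + γ) * z.1 = α * p.1 + β * q.1 + γ * r.1 := by exact_mod_cast h1
    have h2' : ((α : ℝ) + β + γ) * z.2 = α * p.2 + β * q.2 + γ * r.2 := by exact_mod_cast h2
    have hs := hc.sum_mem (t := Finset.univ)
      (w := ![(α : ℝ) / (α + β + γ), (β : ℝ) / (α + β + γ), (γ : ℝ) / (α + β + γ)])
      (z := ![toR2 p, toR2 q, toR2 r])
      (by intro i _; fin_cases i <;> simp <;> positivity)
      (by simp only [Fin.sum_univ_three, Matrix.cons_val]; field_simp)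
      (by intro i _; fin_cases i <;> simp [hmem, hp, hq, hr])
    simp only [Fin.sum_univ_three, Matrix.cons_val] at hs
    convert hs using 1
    ext
    · simp only [toR2, Prod.fst_add, Prod.smul_fst, smul_eq_mul]
      field_simp
      linarith
    · simp only [toR2, Prod.snd_add, Prod.smul_snd, smul_eq_mul]
      field_simp
      linarith
  have : z ∈ (S : Set (ℤ × ℤ)) := by
    rw [← hS]; exact key
  exact_mod_cast this

/-- The lattice points of the triangle with base from `(0, 0)` to `(d, 0)` and apex `(p, ε * h)`
belong to the set. -/
theorem TriangleClosed.mem_of_chord {S : Finset (ℤ × ℤ)} (hS : TriangleClosed S) {d p h ε x t : ℤ}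
    (hd : 0 < d) (h0 : ((0, 0) : ℤ × ℤ) ∈ S) (h1 : (d, 0) ∈ S) (hP : (p, ε * h) ∈ S)
    (hh : 0 < h) (ht : 0 ≤ t) (hx : p * t ≤ x * h) (hx' : x * h ≤ p * t + d * (h - t)) :
    (x, ε * t) ∈ S := by
  have hdh : 0 < d * h := mul_pos hd hh
  have hdt : 0 ≤ t * d := mul_nonneg ht hd.le
  refine hS _ h0 _ h1 _ hP (d * h - t * d - (x * h - p * t)) (x * h - p * t) (t * d)
    (by linarith) (by linarith) hdt (by linarith) _ ?_ ?_
  · simp only; ring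
  · simp only; ring

theorem exists_ceil_mul (a : ℤ) {h : ℤ} (hh : 0 < h) : ∃ c : ℤ, a ≤ c * h ∧ c * h < a + h := by
  refine ⟨-((-a) / h), ?_, ?_⟩
  · have := Int.ediv_mul_le (-a) hh.ne'
    linarith
  · have := Int.lt_ediv_add_one_mul_self (-a) hh
    linarith

theorem TriangleClosed.le_card_row_add_card_row {S : Finset (ℤ × ℤ)} (hS : TriangleClosed S)
    {d p h ε t : ℤ} (hd : 0 < d) (h0 : ((0, 0) : ℤ × ℤ) ∈ S) (h1 : (d, 0) ∈ S)
    (hP : (p, ε * h) ∈ S) (ht : 0 < t) (hth : t < h) :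
    d ≤ ((S.filter fun z => z.2 = ε * t).card : ℤ) +
      (S.filter fun z => z.2 = ε * (h - t)).card := by
  have hh : 0 < h := ht.trans hth
  obtain ⟨c, hc, hc'⟩ := exists_ceil_mul (p * t) hh
  set I := Finset.Ico c (c + d)
  have hI : (I.card : ℤ) = d := by simp [I, hd.le]
  have hsplit := Finset.card_filter_add_card_filter_not (s := I)
    (fun x => x * h ≤ p * t + d * (h - t))
  have hA : (I.filter fun x => x * h ≤ p * t + d * (h - t)).card ≤
      (S.filter fun z => z.2 = ε * t).card := by
    refine Finset.card_le_card_of_injOn (fun x => (x, ε * t)) ?_ ?_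
    · intro x hx
      simp only [I, Finset.coe_filter, Finset.mem_Ico, Set.mem_ofPred_eq] at hx ⊢
      refine ⟨hS.mem_of_chord hd h0 h1 hP hh ht.le ?_ hx.2, trivial⟩
      nlinarith [hx.1.1]
    · intro x _ y _ hxy
      exact (Prod.mk.inj hxy).1
  have hB : (I.filter fun x => ¬ x * h ≤ p * t + d * (h - t)).card ≤
      (S.filter fun z => z.2 = ε * (h - t)).card := by
    refine Finset.card_le_card_of_injOn (fun x => (p + d - x, ε * (h - t))) ?_ ?_
    · intro x hx
      simp only [I, Finset.coe_filter, Finset.mem_Ico, Set.mem_ofPred_eq, not_le] at hx ⊢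
      refine ⟨hS.mem_of_chord hd h0 h1 hP hh (by linarith) ?_ ?_, trivial⟩
      · nlinarith [hx.1.2]
      · nlinarith [hx.2]
    · intro x _ y _ hxy
      have := (Prod.mk.inj hxy).1
      linarith
  omega

theorem TriangleClosed.mul_height_le {S : Finset (ℤ × ℤ)} (hS : TriangleClosed S)
    {d p h ε : ℤ} (hε : ε * ε = 1) (hd : 2 ≤ d) (h0 : ((0, 0) : ℤ × ℤ) ∈ S) (h1 : (d, 0) ∈ S)
    (hP : (p, ε * h) ∈ S) (hh : 0 ≤ h) :
    d * h ≤ 2 * ((S.filter fun z => 0 < ε * z.2 ∧ ε * z.2 ≤ h).card : ℤ) + d - 2 := by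
  rcases hh.eq_or_lt with rfl | hh
  · have := Int.natCast_nonneg (S.filter fun z => 0 < ε * z.2 ∧ ε * z.2 ≤ 0).card
    linarith
  set N : ℤ → ℤ := fun t => ((S.filter fun z => z.2 = ε * t).card : ℤ) with hN
  have hcard : ((S.filter fun z => 0 < ε * z.2 ∧ ε * z.2 ≤ h).card : ℤ) =
      ∑ t ∈ Finset.Ioc 0 h, N t := by
    rw [Finset.card_eq_sum_card_fiberwise (f := fun z => ε * z.2) (t := Finset.Ioc 0 h)]
    · push_cast
      refine Finset.sum_congr rfl fun t ht => ?_
      simp only [hN, Finset.filter_filter]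
      congr 2
      ext z
      simp only [Finset.mem_filter, Finset.mem_Ioc] at ht ⊢
      refine and_congr_right fun _ => ⟨fun hz => ?_, fun hz => ?_⟩
      · rw [← hz.2, ← mul_assoc, hε, one_mul]
      · have : ε * z.2 = t := by rw [hz, ← mul_assoc, hε, one_mul]
        exact ⟨by rwa [this], this⟩
    · intro z hz
      simpa using (Finset.mem_filter.1 hz).2
  have htop : 1 ≤ N h := by
    have : 0 < (S.filter fun z => z.2 = ε * h).card :=
      Finset.card_pos.2 ⟨(p, ε * h), Finset.mem_filter.2 ⟨hP, rfl⟩⟩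
    simp only [hN]
    exact_mod_cast this
  have hsum : ∑ t ∈ Finset.Ioc 0 h, N t = ∑ t ∈ Finset.Ioo 0 h, N t + N h := by
    rw [← Finset.Ioo_insert_right hh, Finset.sum_insert (by simp), add_comm]
  have hrefl : ∑ t ∈ Finset.Ioo 0 h, N (h - t) = ∑ t ∈ Finset.Ioo 0 h, N t := by
    refine Finset.sum_nbij' (fun t => h - t) (fun t => h - t) ?_ ?_ ?_ ?_ ?_ <;>
      simp +contextual
  have hpair : ∑ _t ∈ Finset.Ioo 0 h, d ≤ ∑ t ∈ Finset.Ioo 0 h, (N t + N (h - t)) :=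
    Finset.sum_le_sum fun t ht =>
      hS.le_card_row_add_card_row (by linarith) h0 h1 hP
        (Finset.mem_Ioo.1 ht).1 (Finset.mem_Ioo.1 ht).2
  rw [Finset.sum_add_distrib, hrefl, Finset.sum_const, Int.card_Ioo, nsmul_eq_mul,
    Int.toNat_of_nonneg (by linarith)] at hpair
  rw [hcard, hsum]
  linarith

theorem TriangleClosed.mul_height_add_height_le {S : Finset (ℤ × ℤ)} (hS : TriangleClosed S)
    {d p q h k : ℤ} (hd : 2 ≤ d) (h0 : ((0, 0) : ℤ × ℤ) ∈ S) (h1 : (d, 0) ∈ S)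
    (hP : (p, h) ∈ S) (hQ : (q, -k) ∈ S) (hh : 0 ≤ h) (hk : 0 ≤ k) :
    d * (h + k) + 6 ≤ 2 * (S.card : ℤ) := by
  have hup := hS.mul_height_le (ε := 1) (by norm_num) hd h0 h1 (by simpa using hP) hh
  have hdown := hS.mul_height_le (ε := -1) (by norm_num) hd h0 h1 (by simpa using hQ) hk
  set A := S.filter fun z => 0 < 1 * z.2 ∧ 1 * z.2 ≤ h
  set B := S.filter fun z => 0 < -1 * z.2 ∧ -1 * z.2 ≤ k
  set C := S.filter fun z => z.2 = 0
  have hC : d + 1 ≤ (C.card : ℤ) := by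
    have hle : (Finset.Icc 0 d).card ≤ C.card := by
      refine Finset.card_le_card_of_injOn (fun x => (x, 0)) ?_ ?_
      · intro x hx
        simp only [Finset.coe_Icc, Set.mem_Icc] at hx
        refine Finset.mem_coe.2 (Finset.mem_filter.2 ⟨?_, rfl⟩)
        exact hS _ h0 _ h1 _ h1 (d - x) x 0 (by linarith) hx.1 le_rfl (by linarith) _
          (by simp only; ring) (by simp only; ring)
      · intro x _ y _ hxy
        exact (Prod.mk.inj hxy).1
    rw [Int.card_Icc] at hle
    omega
  have hAB : Disjoint A B := by
    refine Finset.disjoint_left.2 fun z hz hz' => ?_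
    have := (Finset.mem_filter.1 hz).2
    have := (Finset.mem_filter.1 hz').2
    omega
  have hABC : Disjoint (A ∪ B) C := by
    refine Finset.disjoint_left.2 fun z hz hz' => ?_
    have := (Finset.mem_filter.1 hz').2
    rcases Finset.mem_union.1 hz with hz | hz
    all_goals
      have := (Finset.mem_filter.1 hz).2
      omega
  have hle : (A ∪ B ∪ C).card ≤ S.card := Finset.card_le_card <|
    Finset.union_subset (Finset.union_subset (Finset.filter_subset _ _) (Finset.filter_subset _ _))
      (Finset.filter_subset _ _)
  rw [Finset.card_union_of_disjoint hABC, Finset.card_union_of_disjoint hAB] at hle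
  have hle' : (A.card : ℤ) + B.card + C.card ≤ S.card := by exact_mod_cast hle
  linarith

/-- Replacing the points of extreme height by the origin when they lie on the wrong side of
the horizontal axis. -/
theorem exists_heights {S : Finset (ℤ × ℤ)} (h0 : ((0, 0) : ℤ × ℤ) ∈ S) {P Q : ℤ × ℤ}
    (hP : P ∈ S) (hQ : Q ∈ S) : ∃ p q h k : ℤ, 0 ≤ h ∧ 0 ≤ k ∧ (p, h) ∈ S ∧ (q, -k) ∈ S ∧
      P.2 - Q.2 ≤ h + k := by
  obtain ⟨p, h, hh, hPS, hle⟩ : ∃ p h : ℤ, 0 ≤ h ∧ (p, h) ∈ S ∧ P.2 ≤ h := by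
    rcases le_total 0 P.2 with hp | hp
    · exact ⟨P.1, P.2, hp, hP, le_rfl⟩
    · exact ⟨0, 0, le_rfl, h0, hp⟩
  obtain ⟨q, k, hk, hQS, hle'⟩ : ∃ q k : ℤ, 0 ≤ k ∧ (q, -k) ∈ S ∧ -Q.2 ≤ k := by
    rcases le_total 0 Q.2 with hq | hq
    · exact ⟨0, 0, le_rfl, by simpa using h0, by linarith⟩
    · exact ⟨Q.1, -Q.2, by linarith, by simpa using hQ, le_rfl⟩
  exact ⟨p, q, h, k, hh, hk, hPS, hQS, by linarith⟩

/-- Two distinct points of `S` are congruent modulo `m`. -/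
def HasCongruentPair (S : Finset (ℤ × ℤ)) (m : ℤ) : Prop :=
  ∃ a ∈ S, ∃ b ∈ S, a ≠ b ∧ m ∣ b.1 - a.1 ∧ m ∣ b.2 - a.2

theorem hasCongruentPair_of_sq_lt_card {S : Finset (ℤ × ℤ)} {k : ℕ} (hk : 0 < k)
    (h : k ^ 2 < S.card) : HasCongruentPair S k := by
  have : NeZero k := ⟨hk.ne'⟩
  obtain ⟨a, ha, b, hb, hab, heq⟩ := Finset.exists_ne_map_eq_of_card_lt_of_maps_to
    (s := S) (t := (Finset.univ : Finset (ZMod k × ZMod k)))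
    (by simpa [ZMod.card, sq] using h)
    (f := fun z => ((z.1 : ZMod k), (z.2 : ZMod k))) (fun _ _ => by simp)
  have h1 := (Prod.mk.inj heq).1
  have h2 := (Prod.mk.inj heq).2
  exact ⟨a, ha, b, hb, hab, (ZMod.intCast_eq_intCast_iff_dvd_sub _ _ _).1 h1,
    (ZMod.intCast_eq_intCast_iff_dvd_sub _ _ _).1 h2⟩

/-- A congruent pair can be brought, by an affine unimodular map, to a horizontal segment
starting at the origin. -/
theorem TriangleClosed.exists_normalization {S : Finset (ℤ × ℤ)} (hS : TriangleClosed S) {k : ℤ}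
    (hpair : HasCongruentPair S k) :
    ∃ T : Finset (ℤ × ℤ), T.card = S.card ∧ TriangleClosed T ∧ (0, 0) ∈ T ∧ (k, 0) ∈ T ∧
      (∀ m, HasCongruentPair T m → HasCongruentPair S m) ∧
      ∃ u : ℤ × ℤ, u ≠ 0 ∧ ∀ a ∈ S, ∀ b ∈ S, ∃ a' ∈ T, ∃ b' ∈ T,
        u.1 * (b.1 - a.1) + u.2 * (b.2 - a.2) = b'.2 - a'.2 := by
  obtain ⟨a, ha, b, hb, hab, ⟨m, hm⟩, ⟨l, hl⟩⟩ := hpair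
  have hml : 0 < Int.gcd m l := by
    refine Int.gcd_pos_iff.2 ?_
    by_contra! hz
    exact hab (Prod.ext (by rw [hz.1] at hm; linarith) (by rw [hz.2] at hl; linarith))
  obtain ⟨v₁, v₂, hcop, hv₁, hv₂⟩ := Int.exists_gcd_one hml
  set g : ℤ := (Int.gcd m l : ℤ)
  have hg : 0 < g := Int.natCast_pos.2 hml
  obtain ⟨r, s, hrs⟩ := Int.isCoprime_iff_gcd_eq_one.2 hcop
  let e : ℤ × ℤ ≃ ℤ × ℤ :=
    { toFun := fun z => (r * (z.1 - a.1) + s * (z.2 - a.2), v₁ * (z.2 - a.2) - v₂ * (z.1 - a.1))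
      invFun := fun z => (a.1 + z.1 * v₁ - z.2 * s, a.2 + z.1 * v₂ + z.2 * r)
      left_inv := fun z => by
        ext
        · simp only; linear_combination (z.1 - a.1) * hrs
        · simp only; linear_combination (z.2 - a.2) * hrs
      right_inv := fun z => by
        ext
        · simp only; linear_combination z.1 * hrs
        · simp only; linear_combination z.2 * hrs }
  have hmem : ∀ z, z ∈ S.map e.toEmbedding ↔ e.symm z ∈ S := fun z => by
    simp [Finset.mem_map_equiv]
  have hsymm : ∀ z, e.symm z = (a.1 + z.1 * v₁ - z.2 * s, a.2 + z.1 * v₂ + z.2 * r) :=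
    fun _ => rfl
  refine ⟨S.map e.toEmbedding, Finset.card_map _, ?_, ?_, ?_, ?_, (-v₂, v₁), ?_, ?_⟩
  · intro p hp q hq t ht α β γ hα hβ hγ hpos z hz1 hz2
    rw [hmem] at hp hq ht ⊢
    refine hS _ hp _ hq _ ht α β γ hα hβ hγ hpos _ ?_ ?_
    · simp only [hsymm]
      linear_combination v₁ * hz1 - s * hz2
    · simp only [hsymm]
      linear_combination v₂ * hz1 + r * hz2
  · rw [hmem, hsymm]
    simpa using ha
  · rw [hmem, hsymm]
    refine hS _ ha _ ha _ hb (g - 1) 0 1 (by omega) le_rfl zero_le_one (by omega) _ ?_ ?_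
    · simp only
      linear_combination (-1 : ℤ) * hm - k * hv₁
    · simp only
      linear_combination (-1 : ℤ) * hl - k * hv₂
  · rintro n ⟨p, hp, q, hq, hpq, ⟨x, hx⟩, ⟨y, hy⟩⟩
    rw [hmem] at hp hq
    refine ⟨_, hp, _, hq, e.symm.injective.ne hpq, ⟨x * v₁ - y * s, ?_⟩, ⟨x * v₂ + y * r, ?_⟩⟩
    · simp only [hsymm]
      linear_combination v₁ * hx - s * hy
    · simp only [hsymm]
      linear_combination v₂ * hx + r * hy
  · intro hu
    have h1 : v₁ = 0 := (Prod.mk.inj hu).2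
    have h2 : v₂ = 0 := by simpa using (Prod.mk.inj hu).1
    simp [h1, h2] at hrs
  · intro p hp q hq
    refine ⟨e p, Finset.mem_map_of_mem _ hp, e q, Finset.mem_map_of_mem _ hq, ?_⟩
    simp only [e, Equiv.coe_fn_mk]
    ring

theorem latticeWidth_le {S : Finset (ℤ × ℤ)} (hne : S.Nonempty) {B : ℤ} {u : ℤ × ℤ} (hu : u ≠ 0)
    (h : ∀ a ∈ S, ∀ b ∈ S, u.1 * (b.1 - a.1) + u.2 * (b.2 - a.2) ≤ B) :
    latticeWidth (S : Set (ℤ × ℤ)) ≤ B := by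
  obtain ⟨o, ho⟩ := hne
  have hfin : ∀ u : ℤ × ℤ, {d : ℤ | ∃ a ∈ (S : Set (ℤ × ℤ)), ∃ b ∈ (S : Set (ℤ × ℤ)),
      d = u.1 * (b.1 - a.1) + u.2 * (b.2 - a.2)}.Finite := fun u => by
    refine ((S ×ˢ S).image fun z : (ℤ × ℤ) × (ℤ × ℤ) =>
      u.1 * (z.2.1 - z.1.1) + u.2 * (z.2.2 - z.1.2)).finite_toSet.subset ?_
    rintro d ⟨a, ha, b, hb, rfl⟩
    exact Finset.mem_coe.2 (Finset.mem_image.2 ⟨(a, b), Finset.mem_product.2 ⟨ha, hb⟩, rfl⟩)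
  have hbdd : BddBelow {w : ℤ | ∃ u : ℤ × ℤ, u ≠ 0 ∧
      w = sSup {d : ℤ | ∃ a ∈ (S : Set (ℤ × ℤ)), ∃ b ∈ (S : Set (ℤ × ℤ)),
        d = u.1 * (b.1 - a.1) + u.2 * (b.2 - a.2)}} := by
    refine ⟨0, ?_⟩
    rintro w ⟨u, -, rfl⟩
    exact le_csSup (hfin u).bddAbove ⟨o, ho, o, ho, by ring⟩
  refine (csInf_le hbdd ⟨u, hu, rfl⟩).trans (csSup_le ⟨0, o, ho, o, ho, by ring⟩ ?_)
  rintro d ⟨a, ha, b, hb, rfl⟩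
  exact h a ha b hb

theorem TriangleClosed.mul_latticeWidth_le {S : Finset (ℤ × ℤ)} (hS : TriangleClosed S) {k : ℤ}
    (hk : 2 ≤ k) (hpair : HasCongruentPair S k) :
    k * latticeWidth (S : Set (ℤ × ℤ)) + 6 ≤ 2 * (S.card : ℤ) := by
  have hne : S.Nonempty := let ⟨a, ha, _⟩ := hpair; ⟨a, ha⟩
  obtain ⟨T, hcard, hT, h0, h1, -, u, hu, huT⟩ := hS.exists_normalization hpair
  have hw : latticeWidth (S : Set (ℤ × ℤ)) ≤ (2 * (S.card : ℤ) - 6) / k := by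
    refine latticeWidth_le hne hu fun a ha b hb => ?_
    obtain ⟨Q, hQ, P, hP, heq⟩ := huT a ha b hb
    obtain ⟨p, q, h, l, hh, hl, hp, hq, hle⟩ := exists_heights h0 hP hQ
    have := hT.mul_height_add_height_le hk h0 h1 hp hq hh hl
    rw [heq, Int.le_ediv_iff_mul_le (by linarith), ← hcard]
    nlinarith
  have := Int.mul_le_of_le_ediv (by linarith) hw
  linarith

theorem TriangleClosed.hasCongruentPair_five {T : Finset (ℤ × ℤ)} (hT : TriangleClosed T)
    {p h ε : ℤ} (hε : ε * ε = 1) (h0 : ((0, 0) : ℤ × ℤ) ∈ T) (h1 : ((4, 0) : ℤ × ℤ) ∈ T)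
    (hP : (p, ε * h) ∈ T) (hh : h = 5 ∨ 7 ≤ h) : HasCongruentPair T 5 := by
  obtain ⟨c, hc⟩ : ∃ c, (c, ε * 5) ∈ T := by
    rcases hh with rfl | hh
    · exact ⟨p, hP⟩
    · obtain ⟨c, hc, hc'⟩ := exists_ceil_mul (p * 5) (show 0 < h by linarith)
      exact ⟨c, hT.mem_of_chord (by norm_num) h0 h1 hP (by linarith) (by norm_num) hc
        (by linarith)⟩
  have hmod : (c % 5, (0 : ℤ)) ∈ T :=
    hT _ h0 _ h1 _ h1 (4 - c % 5) (c % 5) 0 (by omega) (by omega) le_rfl (by omega) _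
      (by simp only; ring) (by simp only; ring)
  refine ⟨_, hmod, _, hc, ?_, ?_, ?_⟩
  · intro heq
    have := (Prod.mk.inj heq).2
    have : ε = 0 := by omega
    simp [this] at hε
  · simp only
    omega
  · simp

theorem TriangleClosed.latticeWidth_le_ten {S : Finset (ℤ × ℤ)} (hS : TriangleClosed S)
    (hcard : S.card = 25) : latticeWidth (S : Set (ℤ × ℤ)) ≤ 10 := by
  by_cases h5 : HasCongruentPair S 5
  · have := hS.mul_latticeWidth_le (by norm_num) h5
    omega
  have h4 : HasCongruentPair S (4 : ℕ) :=
    hasCongruentPair_of_sq_lt_card (by norm_num) (by omega)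
  obtain ⟨T, hTcard, hT, h0, h1, hTS, u, hu, huT⟩ := hS.exists_normalization h4
  refine latticeWidth_le (Finset.card_pos.1 (by omega)) hu fun a ha b hb => ?_
  obtain ⟨Q, hQ, P, hP, heq⟩ := huT a ha b hb
  obtain ⟨p, q, h, k, hh, hk, hp, hq, hle⟩ := exists_heights h0 hP hQ
  have hbound := hT.mul_height_add_height_le (by norm_num) h0 h1 hp hq hh hk
  rw [hTcard, hcard] at hbound
  push_cast at hbound
  rw [heq]
  by_contra! hlt
  refine h5 (hTS 5 ?_)
  by_cases hh' : h = 5 ∨ 7 ≤ h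
  · exact hT.hasCongruentPair_five (ε := 1) (by norm_num) h0 h1 (by simpa using hp) hh'
  · exact hT.hasCongruentPair_five (ε := -1) (by norm_num) h0 h1 (by simpa using hq)
      (show k = 5 ∨ 7 ≤ k by omega)

theorem TriangleClosed.latticeWidth_add_one_pow_four_le {S : Finset (ℤ × ℤ)}
    (hS : TriangleClosed S) (hn : 25 ≤ S.card)
    (hw : 0 ≤ latticeWidth (S : Set (ℤ × ℤ)) + 1) :
    (latticeWidth (S : Set (ℤ × ℤ)) + 1) ^ 4 ≤ (S.card : ℤ) ^ 3 := by
  rcases hn.eq_or_lt with hn | hn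
  · have := hS.latticeWidth_le_ten hn.symm
    rw [← hn]
    calc _ ≤ (11 : ℤ) ^ 4 := by gcongr; linarith
      _ ≤ _ := by norm_num
  obtain ⟨k, hk5, hlo, hhi⟩ : ∃ k : ℕ, 5 ≤ k ∧ k ^ 2 < S.card ∧ S.card ≤ (k + 1) ^ 2 := by
    refine ⟨Nat.sqrt (S.card - 1), ?_, ?_, ?_⟩
    · exact Nat.le_sqrt.2 (by omega)
    · have := Nat.sqrt_le' (S.card - 1)
      omega
    · have := Nat.lt_succ_sqrt' (S.card - 1)
      rw [Nat.succ_eq_add_one] at this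
      omega
  have hb := hS.mul_latticeWidth_le (k := k) (by omega)
    (hasCongruentPair_of_sq_lt_card (by omega) hlo)
  generalize latticeWidth (S : Set (ℤ × ℤ)) = w at *
  generalize S.card = n at *
  obtain hk | hk | hk : k = 5 ∨ k = 6 ∨ 7 ≤ k := by omega
  · subst hk
    obtain ⟨W, hW⟩ : ∃ W : ℤ, W = (2 * n - 6) / 5 := ⟨_, rfl⟩
    have hwW : w + 1 ≤ W + 1 := by omega
    refine (pow_le_pow_left₀ hw hwW 4).trans ?_
    subst hW
    interval_cases n <;> norm_num
  · subst hk
    obtain ⟨W, hW⟩ : ∃ W : ℤ, W = (2 * n - 6) / 6 := ⟨_, rfl⟩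
    have hwW : w + 1 ≤ W + 1 := by omega
    refine (pow_le_pow_left₀ hw hwW 4).trans ?_
    subst hW
    interval_cases n <;> norm_num
  · zify at hk hlo hhi
    generalize (k : ℤ) = k at *
    generalize (n : ℤ) = n at *
    have hwk : w + 1 ≤ 2 * k + 4 := by
      by_contra! hlt
      nlinarith
    have hcube : (2 * k + 4) ^ 2 ≤ k ^ 3 := by
      nlinarith [mul_nonneg (sq_nonneg k) (sub_nonneg.2 hk),
        mul_nonneg (by linarith : 0 ≤ k) (sub_nonneg.2 hk)]
    calc (w + 1) ^ 4 ≤ (2 * k + 4) ^ 4 := by gcongr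
      _ = ((2 * k + 4) ^ 2) ^ 2 := by ring
      _ ≤ (k ^ 3) ^ 2 := by gcongr
      _ = (k ^ 2) ^ 3 := by ring
      _ ≤ n ^ 3 := by gcongr

theorem width_succ_le_rpow
    (S : Set (ℤ × ℤ)) (hfin : S.Finite) (hne : S.Nonempty)
    (hdc : DigitalConvex S) (hn : 25 ≤ S.ncard) :
    (latticeWidth S : ℝ) + 1 ≤ (S.ncard : ℝ) ^ ((3 : ℝ) / 4) := by
  obtain ⟨F, rfl⟩ : ∃ F : Finset (ℤ × ℤ), (F : Set (ℤ × ℤ)) = S :=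
    ⟨hfin.toFinset, hfin.coe_toFinset⟩
  rw [Set.ncard_coe_finset] at hn ⊢
  have hnonneg : (0 : ℝ) ≤ (F.card : ℝ) ^ ((3 : ℝ) / 4) := by positivity
  rcases le_total 0 (latticeWidth (F : Set (ℤ × ℤ)) + 1) with hw | hw
  · have hpow := hdc.triangleClosed.latticeWidth_add_one_pow_four_le hn hw
    have hpow' : ((latticeWidth (F : Set (ℤ × ℤ)) : ℝ) + 1) ^ 4 ≤ (F.card : ℝ) ^ 3 := by
      exact_mod_cast hpow
    refine le_of_pow_le_pow_left₀ (n := 4) (by norm_num) hnonneg (hpow'.trans_eq ?_)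
    rw [← Real.rpow_natCast, ← Real.rpow_natCast, ← Real.rpow_mul (by positivity)]
    norm_num
  · have : (latticeWidth (F : Set (ℤ × ℤ)) : ℝ) + 1 ≤ 0 := by exact_mod_cast hw
    linarith
end

section
/- Let S ⊆ ℤ² be a finite digital convex set, let u ∈ ℤ² be nonzero, let P ⊆ ℤ² be finite and nonempty, and let k ≥ 1 be an integer such that P + (k−1)·u ⊆ S and (P + k·u) ∩ S = ∅ (where P + m·u = {p + m·u : p ∈ P}). Then (P + u) ∩ conv(P) = ∅, where conv(P) is the convex hull in ℝ² of P (viewing ℤ² ⊆ ℝ²). -/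
theorem translate_disjoint_convexHull
    (S : Set (ℤ × ℤ)) (hS : S.Finite) (hdc : DigitalConvex S)
    (u : ℤ × ℤ) (hu : u ≠ 0)
    (P : Set (ℤ × ℤ)) (hPfin : P.Finite) (hPne : P.Nonempty)
    (k : ℤ) (hk : 1 ≤ k)
    (h1 : ((fun p => p + (k - 1) • u) '' P) ⊆ S)
    (h2 : ((fun p => p + k • u) '' P) ∩ S = ∅) :
    (toR2 '' ((fun p => p + u) '' P)) ∩ convexHull ℝ (toR2 '' P) = ∅ := by
  rw [Set.eq_empty_iff_forall_notMem]
  rintro _ ⟨⟨_, ⟨p, hp, rfl⟩, rfl⟩, hconv⟩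
  refine Set.eq_empty_iff_forall_notMem.mp h2 (p + k • u) ⟨⟨p, hp, rfl⟩, ?_⟩
  have toR2_add (a b : ℤ × ℤ) : toR2 (a + b) = toR2 a + toR2 b := by simp [toR2]
  have hsub : convexHull ℝ (toR2 '' P) ⊆
      (fun x => x + toR2 ((k - 1) • u)) ⁻¹' convexHull ℝ (toR2 '' S) := by
    refine convexHull_min ?_ ((convex_convexHull ℝ _).translate_preimage_left _)
    rintro _ ⟨q, hq, rfl⟩
    rw [Set.mem_preimage, ← toR2_add]
    exact subset_convexHull ℝ _ ⟨_, h1 ⟨q, hq, rfl⟩, rfl⟩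
  have hmem := hsub hconv
  rw [Set.mem_preimage, ← toR2_add, add_assoc, ← one_add_zsmul, add_sub_cancel] at hmem
  rw [← hdc]
  exact hmem
end

section
/- Let S ⊆ ℤ² be a finite digital convex set, let u ∈ ℤ² be nonzero, let P ⊆ ℤ² be finite and nonempty, and let k⁺ ≥ 1 and k⁻ ≤ −1 be integers such that P + (k⁺−1)·u ⊆ S, P + (k⁻+1)·u ⊆ S, (P + k⁺·u) ∩ S = ∅, and (P + k⁻·u) ∩ S = ∅. Then the convex hull conv(P) contains at most one lattice point on each line parallel to u; that is, there is no lattice point z ∈ ℤ² and nonzero integer m with both z ∈ conv(P) and z + m·u ∈ conv(P). -/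
theorem exists_forall_add_smul_mem_of_notMem_extremePoints {E : Type*} [AddCommGroup E] [Module ℝ E]
    {Q : Set E} (hQ : Convex ℝ Q) {x : E} (hx : x ∈ Q) (hext : x ∉ Set.extremePoints ℝ Q) :
    ∃ w : E, w ≠ 0 ∧ ∀ t : ℝ, |t| ≤ 1 → x + t • w ∈ Q := by
  rw [mem_extremePoints] at hext
  push Not at hext
  obtain ⟨a, ha, b, hb, ⟨α, β, hα, hβ, hαβ, rfl⟩, hne⟩ := hext hx
  have hab : a ≠ b := by
    rintro rfl
    have h : α • a + β • a = a := by rw [← add_smul, hαβ, one_smul]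
    exact hne h.symm h.symm
  refine ⟨(min α β) • (b - a), smul_ne_zero (lt_min hα hβ).ne' (sub_ne_zero.mpr hab.symm), ?_⟩
  intro t ht
  obtain ⟨ht1, ht2⟩ := abs_le.mp ht
  have hm : 0 < min α β := lt_min hα hβ
  have h1 := min_le_left α β
  have h2 := min_le_right α β
  have key : α • a + β • b + t • (min α β) • (b - a)
      = (α - t * min α β) • a + (β + t * min α β) • b := by
    module
  rw [key]
  exact hQ ha hb (by nlinarith) (by nlinarith) (by linarith)

theorem exists_eq_smul_of_cross_eq_zero {v z : ℝ × ℝ} (hv : v ≠ 0)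
    (h : v.1 * z.2 - v.2 * z.1 = 0) : ∃ s : ℝ, z = s • v := by
  have hpos : v.1 * v.1 + v.2 * v.2 ≠ 0 := by
    intro h0
    apply hv
    ext <;> simp <;> nlinarith [mul_self_nonneg v.1, mul_self_nonneg v.2]
  refine ⟨(v.1 * z.1 + v.2 * z.2) / (v.1 * v.1 + v.2 * v.2), ?_⟩
  ext
  · simp only [Prod.smul_fst, smul_eq_mul]
    rw [div_mul_eq_mul_div, eq_div_iff hpos]
    linear_combination (-v.2) * h
  · simp only [Prod.smul_snd, smul_eq_mul]
    rw [div_mul_eq_mul_div, eq_div_iff hpos]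
    linear_combination v.1 * h

/-- A longest chord of `Q` in a given direction. -/
theorem exists_longest_chord_s10 {Q : Set (ℝ × ℝ)} (hQ : IsCompact Q)
    {v x : ℝ × ℝ} (hv : v ≠ 0) (hx : x ∈ Q) (hxv : x + v ∈ Q) :
    ∃ M : ℝ, 1 ≤ M ∧ (∃ y ∈ Q, y + M • v ∈ Q) ∧
      ∀ t : ℝ, ∀ y ∈ Q, y + t • v ∈ Q → t ≤ M := by
  have hK : IsCompact ((Q ×ˢ Q) ∩ Set.range (fun q : (ℝ × ℝ) × ℝ => (q.1, q.1 + q.2 • v))) := by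
    have : Set.range (fun q : (ℝ × ℝ) × ℝ => (q.1, q.1 + q.2 • v))
        = {q : (ℝ × ℝ) × (ℝ × ℝ) | v.1 * (q.2 - q.1).2 - v.2 * (q.2 - q.1).1 = 0} := by
      ext ⟨a, b⟩
      constructor
      · rintro ⟨⟨c, t⟩, h⟩
        obtain ⟨rfl, rfl⟩ := Prod.mk.inj h
        simp
        ring
      · intro h
        obtain ⟨s, hs⟩ := exists_eq_smul_of_cross_eq_zero hv h
        exact ⟨(a, s), by simp [← hs]⟩
    rw [this]
    exact (hQ.prod hQ).inter_right (isClosed_eq (by fun_prop) (by fun_prop))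
  have hf : Continuous fun q : (ℝ × ℝ) × (ℝ × ℝ) =>
      v.1 * (q.2 - q.1).1 + v.2 * (q.2 - q.1).2 := by fun_prop
  obtain ⟨_, ⟨⟨hy, hyM⟩, ⟨⟨y, M⟩, rfl⟩⟩, hmax⟩ := hK.exists_isMaxOn
    ⟨(x, x + v), ⟨hx, hxv⟩, ⟨(x, 1), by simp⟩⟩ hf.continuousOn
  have hpos : 0 < v.1 * v.1 + v.2 * v.2 := by
    by_contra! h0
    apply hv
    ext <;> simp <;> nlinarith [mul_self_nonneg v.1, mul_self_nonneg v.2]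
  have hM : ∀ t : ℝ, ∀ z ∈ Q, z + t • v ∈ Q → t ≤ M := by
    intro t z hz hzt
    have h := hmax (a := (z, z + t • v)) ⟨⟨hz, hzt⟩, ⟨(z, t), rfl⟩⟩
    simp only [Set.mem_ofPred_eq, add_sub_cancel_left, Prod.smul_fst, Prod.smul_snd,
      smul_eq_mul] at h
    by_contra! hlt
    nlinarith
  exact ⟨M, hM 1 x hx (by simpa using hxv), ⟨y, hy, hyM⟩, hM⟩

/-- Among the longest chords of a planar convex body in a given direction,
one starts or ends at an extreme point. -/
theorem exists_extremePoint_longest_chord {Q : Set (ℝ × ℝ)} (hQ : IsCompact Q)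
    (hconv : Convex ℝ Q) {v : ℝ × ℝ} (hv : v ≠ 0) {M : ℝ} (hne : ∃ y ∈ Q, y + M • v ∈ Q)
    (hmax : ∀ t : ℝ, ∀ y ∈ Q, y + t • v ∈ Q → t ≤ M) :
    ∃ x ∈ Q, x + M • v ∈ Q ∧ (x ∈ Set.extremePoints ℝ Q ∨ x + M • v ∈ Set.extremePoints ℝ Q) := by
  have hF : IsCompact (Q ∩ (fun y => y + M • v) ⁻¹' Q) :=
    hQ.inter_right (hQ.isClosed.preimage (by fun_prop))
  obtain ⟨y, hy, hyM⟩ := hne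
  obtain ⟨x, hxF⟩ := hF.extremePoints_nonempty ⟨y, hy, hyM⟩
  obtain ⟨⟨hx, hxM⟩, hext⟩ := mem_extremePoints.mp hxF
  rw [Set.mem_preimage] at hxM
  refine ⟨x, hx, hxM, ?_⟩
  by_contra! hno
  obtain ⟨w, hw0, hw⟩ := exists_forall_add_smul_mem_of_notMem_extremePoints hconv hx hno.1
  obtain ⟨w', hw0', hw'⟩ := exists_forall_add_smul_mem_of_notMem_extremePoints hconv hxM hno.2
  set α := v.1 * w.2 - v.2 * w.1 with hα
  set β := v.1 * w'.2 - v.2 * w'.1 with hβ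
  have hα0 : α ≠ 0 := by
    intro h
    obtain ⟨s, rfl⟩ := exists_eq_smul_of_cross_eq_zero hv h
    have hs : s ≠ 0 := by rintro rfl; simp at hw0
    have h1 := hmax (M - s) _ (hw 1 (by simp)) (by convert hxM using 1; module)
    have h2 := hmax (M + s) _ (hw (-1) (by simp)) (by convert hxM using 1; module)
    exact hs (by linarith)
  have hβ0 : β ≠ 0 := by
    intro h
    obtain ⟨s, rfl⟩ := exists_eq_smul_of_cross_eq_zero hv h
    have hs : s ≠ 0 := by rintro rfl; simp at hw0'
    have h1 := hmax (M + s) x hx (by convert hw' 1 (by simp) using 1; module)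
    have h2 := hmax (M - s) x hx (by convert hw' (-1) (by simp) using 1; module)
    exact hs (by linarith)
  have hd : 0 < |α| + |β| := by positivity
  set τ := β / (|α| + |β|) with hτ
  set σ := α / (|α| + |β|) with hσ
  have hτ1 : |τ| ≤ 1 := by
    rw [hτ, abs_div, abs_of_pos hd, div_le_one hd]
    linarith [abs_nonneg α]
  have hσ1 : |σ| ≤ 1 := by
    rw [hσ, abs_div, abs_of_pos hd, div_le_one hd]
    linarith [abs_nonneg β]
  have hτ0 : τ ≠ 0 := div_ne_zero hβ0 hd.ne'
  have hcross : v.1 * (σ • w' - τ • w).2 - v.2 * (σ • w' - τ • w).1 = 0 := by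
    have h : σ * β = τ * α := by rw [hτ, hσ]; ring
    simp only [Prod.fst_sub, Prod.snd_sub, Prod.smul_fst, Prod.smul_snd, smul_eq_mul]
    rw [hα, hβ] at h
    linear_combination h
  obtain ⟨s, hs⟩ := exists_eq_smul_of_cross_eq_zero hv hcross
  have hw'eq : σ • w' = τ • w + s • v := by rw [← hs]; abel
  have h1 := hmax (M + s) _ (hw τ hτ1) (by
    convert hw' σ hσ1 using 1
    rw [hw'eq]; module)
  have h2 := hmax (M - s) _ (hw (-τ) (by simpa using hτ1)) (by
    convert hw' (-σ) (by simpa using hσ1) using 1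
    rw [neg_smul σ, hw'eq]; module)
  obtain rfl : s = 0 := by linarith
  have hplus : x + τ • w ∈ Q ∩ (fun y => y + M • v) ⁻¹' Q := by
    refine ⟨hw τ hτ1, ?_⟩
    change x + τ • w + M • v ∈ Q
    convert hw' σ hσ1 using 1
    rw [hw'eq]; module
  have hminus : x + (-τ) • w ∈ Q ∩ (fun y => y + M • v) ⁻¹' Q := by
    refine ⟨hw (-τ) (by simpa using hτ1), ?_⟩
    change x + (-τ) • w + M • v ∈ Q
    convert hw' (-σ) (by simpa using hσ1) using 1
    rw [neg_smul σ, hw'eq]; module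
  have h := hext _ hplus _ hminus ⟨1 / 2, 1 / 2, by norm_num, by norm_num, by norm_num, by module⟩
  have h0 : τ • w = 0 := by simpa using h.1
  exact (smul_ne_zero hτ0 hw0) h0

/-- If `conv(P)` contains a translate of the segment from `0` to `v`, then it contains one with an
endpoint in `P`. -/
theorem exists_mem_add_or_sub_mem_convexHull {P : Set (ℝ × ℝ)} (hP : P.Finite) {v x : ℝ × ℝ}
    (hv : v ≠ 0) (hx : x ∈ convexHull ℝ P) (hxv : x + v ∈ convexHull ℝ P) :
    ∃ p ∈ P, p + v ∈ convexHull ℝ P ∨ p - v ∈ convexHull ℝ P := by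
  have hQ : IsCompact (convexHull ℝ P) := hP.isCompact_convexHull (𝕜 := ℝ)
  have hconv := convex_convexHull ℝ P
  obtain ⟨M, hM, hne, hmax⟩ := exists_longest_chord_s10 hQ hv hx hxv
  obtain ⟨y, hy, hyM, hext⟩ := exists_extremePoint_longest_chord hQ hconv hv hne hmax
  have hM0 : 0 < M := by linarith
  have h1 : 0 ≤ 1 - 1 / M := by
    rw [sub_nonneg, div_le_one hM0]
    exact hM
  rcases hext with hext | hext
  · refine ⟨y, extremePoints_convexHull_subset hext, Or.inl ?_⟩
    convert hconv hy hyM h1 (by positivity : 0 ≤ 1 / M) (by ring) using 1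
    rw [smul_add, smul_smul, one_div_mul_cancel hM0.ne']
    module
  · refine ⟨_, extremePoints_convexHull_subset hext, Or.inr ?_⟩
    convert hconv hyM hy h1 (by positivity : 0 ≤ 1 / M) (by ring) using 1
    rw [smul_add, smul_smul, sub_mul, one_div_mul_cancel hM0.ne']
    module

theorem toR2_add (a b : ℤ × ℤ) : toR2 (a + b) = toR2 a + toR2 b := by
  simp [toR2]

theorem toR2_zsmul (m : ℤ) (a : ℤ × ℤ) : toR2 (m • a) = (m : ℝ) • toR2 a := by
  simp [toR2]

theorem toR2_ne_zero_s10 {u : ℤ × ℤ} (hu : u ≠ 0) : toR2 u ≠ 0 := by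
  intro h
  apply hu
  simpa [toR2, Prod.ext_iff] using h

theorem DigitalConvex.add_mem {S P : Set (ℤ × ℤ)} (hS : DigitalConvex S) {c q : ℤ × ℤ}
    (hP : (fun p => p + c) '' P ⊆ S) (hq : toR2 q ∈ convexHull ℝ (toR2 '' P)) : q + c ∈ S := by
  have hsub : convexHull ℝ (toR2 '' P) ⊆
      (fun y => y + toR2 c) ⁻¹' convexHull ℝ (toR2 '' S) := by
    refine convexHull_min ?_ ((convex_convexHull ℝ _).translate_preimage_left _)
    rintro _ ⟨p, hp, rfl⟩
    refine subset_convexHull ℝ _ ⟨p + c, hP ⟨p, hp, rfl⟩, toR2_add p c⟩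
  rw [← hS, Set.mem_ofPred_eq, toR2_add]
  exact hsub hq

theorem convexHull_at_most_one_lattice_point_per_line
    (S : Set (ℤ × ℤ)) (hS : S.Finite) (hdc : DigitalConvex S)
    (u : ℤ × ℤ) (hu : u ≠ 0)
    (P : Set (ℤ × ℤ)) (hPfin : P.Finite) (hPne : P.Nonempty)
    (kp km : ℤ) (hkp : 1 ≤ kp) (hkm : km ≤ -1)
    (h1 : ((fun p => p + (kp - 1) • u) '' P) ⊆ S)
    (h2 : ((fun p => p + (km + 1) • u) '' P) ⊆ S)
    (h3 : ((fun p => p + kp • u) '' P) ∩ S = ∅)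
    (h4 : ((fun p => p + km • u) '' P) ∩ S = ∅) :
    ¬ ∃ (z : ℤ × ℤ) (m : ℤ), m ≠ 0 ∧
        toR2 z ∈ convexHull ℝ (toR2 '' P) ∧
        toR2 (z + m • u) ∈ convexHull ℝ (toR2 '' P) := by
  rintro ⟨z, m, hm, hz, hzm⟩
  have hmu : m • u ≠ 0 := smul_ne_zero hm hu
  rw [toR2_add] at hzm
  obtain ⟨_, ⟨p, hp, rfl⟩, hpm⟩ := exists_mem_add_or_sub_mem_convexHull (hPfin.image toR2)
    (toR2_ne_zero_s10 hmu) hz hzm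
  obtain ⟨n, hn, hpn⟩ : ∃ n : ℤ, n ≠ 0 ∧ toR2 p + (n : ℝ) • toR2 u ∈ convexHull ℝ (toR2 '' P) := by
    rw [toR2_zsmul] at hpm
    rcases hpm with h | h
    · exact ⟨m, hm, h⟩
    · exact ⟨-m, neg_ne_zero.mpr hm, by simpa [sub_eq_add_neg] using h⟩
  have hpP : toR2 p ∈ convexHull ℝ (toR2 '' P) := subset_convexHull ℝ _ ⟨p, hp, rfl⟩
  have hstep : ∀ e : ℤ, 1 ≤ n * e → e * e = 1 → toR2 (p + e • u) ∈ convexHull ℝ (toR2 '' P) := by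
    intro e hne he
    have hne' : (1 : ℝ) ≤ n * e := by exact_mod_cast hne
    have he' : (e : ℝ) * e = 1 := by exact_mod_cast he
    have h0 : (0 : ℝ) < n * e := by linarith
    rw [toR2_add, toR2_zsmul]
    convert (convex_convexHull ℝ (toR2 '' P)) hpP hpn
      (sub_nonneg.mpr ((div_le_one h0).mpr hne')) (by positivity : 0 ≤ 1 / ((n : ℝ) * e))
      (by ring) using 1
    have h : 1 / ((n : ℝ) * e) * n = e := by
      rw [div_mul_eq_mul_div, div_eq_iff h0.ne']
      linear_combination (-(n : ℝ)) * he'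
    rw [smul_add, smul_smul, h]
    module
  rcases lt_or_gt_of_ne hn with hneg | hpos
  · have h := hdc.add_mem h2 (hstep (-1) (by omega) (by norm_num))
    have heq : p + (-1 : ℤ) • u + (km + 1) • u = p + km • u := by module
    rw [heq] at h
    exact Set.eq_empty_iff_forall_notMem.mp h4 _ ⟨⟨p, hp, rfl⟩, h⟩
  · have h := hdc.add_mem h1 (hstep 1 (by omega) (by norm_num))
    have heq : p + (1 : ℤ) • u + (kp - 1) • u = p + kp • u := by module
    rw [heq] at h
    exact Set.eq_empty_iff_forall_notMem.mp h3 _ ⟨⟨p, hp, rfl⟩, h⟩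
end
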